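/- arXiv:math/0601589 — 4 statements merged into one kernel-verified Lean document; each statement's English description precedes it below -/
import Mathlib

section
/- Let F be a free group and g a nontrivial element of F. For every m ∈ ℕ there exists a finite index normal subgroup N of F such that gˢ ∉ N for all 1 ≤ s ≤ m. -/
open scoped Nat

namespace FreeGroup

variable {α : Type*}

/-- On a finite set `S` of elements of a free group, the partially defined left translations by
the generators extend to permutations of `S`, and so to an action of the free group on `S`. -/
theorem exists_hom_perm_of_mul_mem (S : Set (FreeGroup α)) [Finite S] :
    ∃ f : FreeGroup α →* Equiv.Perm S, ∀ (p : α × Bool) (x y : S),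
      mk [p] * (x : FreeGroup α) = y → f (mk [p]) x = y := by
  have extend (a : α) : ∃ e : Equiv.Perm S, ∀ x y : S, of a * (x : FreeGroup α) = y → e x = y := by
    obtain ⟨e, he⟩ := Equiv.Perm.exists_extending_pair
      (fun z : {x : S // of a * (x : FreeGroup α) ∈ S} ↦ z.1)
      (fun z ↦ (⟨of a * z.1, z.2⟩ : S)) Subtype.val_injective
      (fun z w h ↦ by simpa [Subtype.ext_iff] using h)
    exact ⟨e, fun x y h ↦ (he ⟨x, h ▸ y.2⟩).trans (Subtype.ext h)⟩
  choose e he using extend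
  refine ⟨lift e, fun ⟨a, b⟩ x y h ↦ ?_⟩
  cases b with
  | true => simpa using he a x y h
  | false =>
    have hinv : mk [(a, false)] = (of a)⁻¹ := by simp [of, inv_mk, invRev]
    rw [hinv] at h ⊢
    rw [_root_.map_inv, lift_apply_of, Equiv.Perm.inv_eq_iff_eq]
    exact (he a y x (by rw [← h, mul_inv_cancel_left])).symm

instance : Group.ResiduallyFinite (FreeGroup α) := by
  rw [Group.residuallyFinite_iff_exists_finiteIndex]
  intro g hg
  obtain ⟨L, rfl⟩ := Quot.exists_rep g
  let S : Set (FreeGroup α) := mk '' {l | l ∈ L.tails}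
  have : Finite S := ((List.finite_toSet L.tails).image mk).to_subtype
  have mem {l : List (α × Bool)} (h : l <:+ L) : mk l ∈ S := ⟨l, (List.mem_tails _ _).2 h, rfl⟩
  obtain ⟨f, hf⟩ := exists_hom_perm_of_mul_mem S
  have one_mem : (1 : FreeGroup α) ∈ S := mem List.nil_suffix
  have orbit (l : List (α × Bool)) (h : l <:+ L) : f (mk l) ⟨1, one_mem⟩ = ⟨mk l, mem h⟩ := by
    induction l with
    | nil => simp [← one_eq_mk]
    | cons p l ih =>
      have hl : l <:+ L := (List.suffix_cons p l).trans h
      have hmul : mk (p :: l) = mk [p] * mk l := by simp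
      calc f (mk (p :: l)) ⟨1, one_mem⟩ = f (mk [p]) ⟨mk l, mem hl⟩ := by
            rw [hmul, _root_.map_mul, Equiv.Perm.mul_apply, ih hl]
        _ = ⟨mk (p :: l), mem h⟩ := hf p _ _ hmul.symm
  refine ⟨f.ker, inferInstance, fun hmem ↦ hg ?_⟩
  have h := orbit L List.suffix_rfl
  rw [show f (mk L) = 1 from hmem] at h
  exact (congrArg Subtype.val h).symm

end FreeGroup

/-- Let F be a free group and g a nontrivial element of F. For every m ∈ ℕ
there exists a finite index normal subgroup N of F with gˢ ∉ N for all 1 ≤ s ≤ m. -/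
theorem stmt_2 {α : Type*} (g : FreeGroup α) (hg : g ≠ 1) (m : ℕ) :
    ∃ N : Subgroup (FreeGroup α), N.Normal ∧ N.FiniteIndex ∧
      ∀ s : ℕ, 1 ≤ s → s ≤ m → g ^ s ∉ N := by
  have hpow : g ^ m ! ≠ 1 := by simpa [m.factorial_ne_zero] using hg
  obtain ⟨N, hN⟩ := Group.exists_finiteIndexNormalSubgroup_notMem _ hpow
  refine ⟨N.toSubgroup, inferInstance, inferInstance, fun s hs hsm hmem ↦ hN ?_⟩
  obtain ⟨k, hk⟩ := Nat.dvd_factorial hs hsm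
  rw [hk, pow_mul]
  exact N.toSubgroup.pow_mem hmem k
end

section
/- Let F be a free group, let g₁, …, g_k be nontrivial elements of F, and let m ∈ ℕ. Then there exists M ∈ ℕ such that for every q ≥ M there is a finite index normal subgroup N of F with the property that for all 1 ≤ i ≤ k: g_iˢ ∉ N whenever 1 ≤ s ≤ m, but g_i^q ∈ N. -/
namespace FreeGroup

/-- Every element of a free group is a product of syllables: nonzero powers of generators, with
consecutive generators distinct. -/
theorem exists_syllables {α : Type*} (g : FreeGroup α) :
    ∃ l : List (α × ℤ), l.IsChain (fun a b => a.1 ≠ b.1) ∧ (∀ p ∈ l, p.2 ≠ 0) ∧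
      (l.map fun p => of p.1 ^ p.2).prod = g := by
  classical
  let w := Monoid.CoprodI.Word.equiv (freeGroupEquivCoprodI g)
  let f : (Σ _ : α, FreeGroup Unit) → α × ℤ := fun p =>
    (p.1, (mulEquivIntOfUnique p.2).toAdd)
  have hw : freeGroupEquivCoprodI g = w.prod := (Monoid.CoprodI.Word.equiv.symm_apply_apply _).symm
  refine ⟨w.toList.map f, ?_, ?_, ?_⟩
  · rw [List.isChain_map]
    exact w.chain_ne
  · intro p hp
    obtain ⟨a, ha, rfl⟩ := List.mem_map.1 hp
    have := w.ne_one a ha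
    simpa [f] using this
  · rw [← freeGroupEquivCoprodI.symm_apply_apply g, hw, Monoid.CoprodI.Word.prod, map_list_prod,
      List.map_map, List.map_map]
    congr 1
    refine List.map_congr_left fun a _ => ?_
    obtain ⟨x, u⟩ := a
    obtain ⟨z, rfl⟩ := (mulEquivIntOfUnique (α := Unit)).symm.surjective u
    induction z using Multiplicative.rec with
    | ofAdd z =>
      have hz : mulEquivIntOfUnique.symm (Multiplicative.ofAdd z) = of () ^ z := rfl
      simp only [f, Function.comp_apply, MulEquiv.apply_symm_apply, toAdd_ofAdd]
      simp [hz]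

end FreeGroup

/-- The element `1 + N` of a ring as a unit, when `N * N = 0`. -/
def Units.oneAddOfSqZero {R : Type*} [Ring R] (N : R) (hN : N * N = 0) : Rˣ where
  val := 1 + N
  inv := 1 - N
  val_inv := by simp [mul_sub, add_mul, hN]
  inv_val := by simp [mul_add, sub_mul, hN]

theorem Units.val_oneAddOfSqZero_zpow {R : Type*} [Ring R] (N : R) (hN : N * N = 0) (e : ℤ) :
    ((Units.oneAddOfSqZero N hN ^ e : Rˣ) : R) = 1 + e • N := by
  induction e using Int.induction_on with
  | zero => simp
  | succ k ih =>
    rw [zpow_add_one, Units.val_mul, ih]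
    simp only [Units.oneAddOfSqZero, mul_add, add_mul, smul_mul_assoc, hN, add_smul]
    simp [add_assoc]
  | pred k ih =>
    rw [zpow_sub_one, Units.val_mul, ih]
    change (1 + (-k : ℤ) • N) * (1 - N) = _
    simp only [mul_sub, add_mul, smul_mul_assoc, hN, sub_smul]
    simp [add_sub_assoc]

namespace Matrix

/-- The strictly upper triangular matrix with an entry `1` in position `(i, i + 1)` whenever `i`
carries the label `x`. -/
noncomputable def labelShift {α : Type*} (n : ℕ) (c : ℕ → Option α) (x : α) :
    Matrix (Fin (n + 1)) (Fin (n + 1)) ℤ :=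
  open scoped Classical in of fun i j => if c i = some x ∧ (i : ℕ) + 1 = j then 1 else 0

theorem labelShift_mul_self {α : Type*} (n : ℕ) {c : ℕ → Option α} {x : α}
    (hc : ∀ i, c i = some x → c (i + 1) ≠ some x) :
    labelShift n c x * labelShift n c x = 0 := by
  ext i j
  rw [mul_apply]
  refine Finset.sum_eq_zero fun k _ => ?_
  simp only [labelShift, of_apply, ite_mul, one_mul, zero_mul]
  split_ifs with h₁ h₂
  · exact absurd (h₁.2 ▸ h₂.1) (hc _ h₁.1)
  all_goals rfl

theorem one_add_labelShift_mul_apply {α : Type*} {n : ℕ} (c : ℕ → Option α) (x : α) (e : ℤ)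
    (P : Matrix (Fin (n + 1)) (Fin (n + 1)) ℤ) (i i' j : Fin (n + 1)) (hi : (i : ℕ) + 1 = i')
    (hx : c i = some x) :
    ((1 + e • labelShift n c x) * P) i j = P i j + e * P i' j := by
  rw [add_mul, one_mul, add_apply, smul_mul_assoc, smul_apply, mul_apply,
    Finset.sum_eq_single i']
  · simp [labelShift, hi, hx]
  · intro k _ hk
    have : (i : ℕ) + 1 ≠ k := fun h => hk (Fin.ext (h.symm.trans hi))
    simp [labelShift, this]
  · simp

theorem prod_one_add_labelShift_apply_eq_zero {α : Type*} {n : ℕ} (c : ℕ → Option α)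
    (l : List (α × ℤ)) (i j : Fin (n + 1)) (h : (i : ℕ) + l.length < j) :
    (l.map fun p => 1 + p.2 • labelShift n c p.1).prod i j = 0 := by
  induction l generalizing i with
  | nil =>
    have : i ≠ j := by rintro rfl; simp at h
    simp [this]
  | cons p l ih =>
    rw [List.length_cons] at h
    rw [List.map_cons, List.prod_cons, add_mul, one_mul, add_apply, ih i (by lia), zero_add,
      smul_mul_assoc, smul_apply, mul_apply, Finset.sum_eq_zero, smul_zero]
    intro k _
    by_cases hk : (i : ℕ) + 1 = k
    · rw [ih k (by lia), mul_zero]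
    · simp [labelShift, hk]

theorem prod_one_add_labelShift_apply {α : Type*} {n : ℕ} (c : ℕ → Option α)
    (l : List (α × ℤ)) (i j : Fin (n + 1)) (hj : (j : ℕ) = i + l.length)
    (hc : ∀ k (hk : k < l.length), c (i + k) = some l[k].1) :
    (l.map fun p => 1 + p.2 • labelShift n c p.1).prod i j = (l.map Prod.snd).prod := by
  induction l generalizing i with
  | nil =>
    have : i = j := Fin.ext (by simpa using hj.symm)
    simp [this]
  | cons p l ih =>
    rw [List.length_cons] at hj
    have hx : c i = some p.1 := hc 0 (by simp)
    rw [List.map_cons, List.prod_cons, one_add_labelShift_mul_apply c p.1 p.2 _ i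
      ⟨i + 1, by lia⟩ j rfl hx, prod_one_add_labelShift_apply_eq_zero c l i j (by lia), zero_add,
      ih ⟨i + 1, by lia⟩ (by simp only; lia), List.map_cons, List.prod_cons]
    intro k hk
    have := hc (k + 1) (by simpa using hk)
    simpa [add_assoc, add_comm 1 k] using this

/-- The submonoid of upper unitriangular matrices. -/
def upperUnitriangular (m R : Type*) [Fintype m] [LinearOrder m] [CommRing R] :
    Submonoid (Matrix m m R) where
  carrier := {A | A.BlockTriangular id ∧ ∀ i, A i i = 1}
  one_mem' := ⟨blockTriangular_one, fun i => one_apply_eq i⟩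
  mul_mem' := by
    rintro A B ⟨hA, hA'⟩ ⟨hB, hB'⟩
    refine ⟨hA.mul hB, fun i => ?_⟩
    rw [mul_apply, Finset.sum_eq_single i]
    · rw [hA', hB', one_mul]
    · intro k _ hk
      rcases lt_or_gt_of_ne hk with h | h
      · rw [hA (show id k < id i from h), zero_mul]
      · rw [hB (show id i < id k from h), mul_zero]
    · simp

theorem sub_one_pow_card_eq_zero {m R : Type*} [Fintype m] [LinearOrder m] [CommRing R]
    {A : Matrix m m R} (hA : A ∈ upperUnitriangular m R) :
    (A - 1) ^ Fintype.card m = 0 := by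
  have h := aeval_self_charpoly A
  rw [charpoly_of_isUpperTriangular A hA.1] at h
  simpa [hA.2] using h

theorem one_add_smul_labelShift_mem {α : Type*} (n : ℕ) (c : ℕ → Option α) (x : α) (e : ℤ) :
    1 + e • labelShift n c x ∈ upperUnitriangular (Fin (n + 1)) ℤ := by
  refine ⟨fun i j hij => ?_, fun i => by simp [labelShift]⟩
  have hij : j < i := hij
  have h₁ : i ≠ j := hij.ne'
  have h₂ : (i : ℕ) + 1 ≠ j := by have := Fin.lt_def.1 hij; lia
  simp [labelShift, h₁, h₂]

end Matrix

/-- A nontrivial element of a free group survives in an integral unitriangular representation. -/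
theorem FreeGroup.exists_unitriangular_rep {α : Type*} {g : FreeGroup α} (hg : g ≠ 1) :
    ∃ (n : ℕ) (φ : FreeGroup α →* (Matrix (Fin (n + 1)) (Fin (n + 1)) ℤ)ˣ),
      (∀ h, (φ h).val ∈ Matrix.upperUnitriangular (Fin (n + 1)) ℤ) ∧
      ∃ i j, i ≠ j ∧ (φ g).val i j ≠ 0 := by
  obtain ⟨l, hl, hl0, rfl⟩ := g.exists_syllables
  let c : ℕ → Option α := fun i => l[i]?.map Prod.fst
  have hc : ∀ x i, c i = some x → c (i + 1) ≠ some x := by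
    intro x i h₁ h₂
    simp only [c, Option.map_eq_some_iff, List.getElem?_eq_some_iff] at h₁ h₂
    obtain ⟨a, ⟨ha, rfl⟩, hax⟩ := h₁
    obtain ⟨b, ⟨hb, rfl⟩, hbx⟩ := h₂
    exact List.isChain_iff_getElem.1 hl i hb (hax.trans hbx.symm)
  let N := Matrix.labelShift l.length c
  have hN : ∀ x, N x * N x = 0 := fun x => Matrix.labelShift_mul_self _ (hc x)
  let φ := FreeGroup.lift fun x => Units.oneAddOfSqZero (N x) (hN x)
  have hφ : ∀ x (e : ℤ), (φ (of x ^ e) : Matrix _ _ ℤ) = 1 + e • N x := fun x e => by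
    rw [map_zpow, FreeGroup.lift_apply_of, Units.val_oneAddOfSqZero_zpow]
  refine ⟨l.length, φ, fun h => ?_, 0, Fin.last _, ?_, ?_⟩
  · induction h using FreeGroup.induction_on with
    | C1 => rw [_root_.map_one]; exact one_mem _
    | of x =>
      have := hφ x 1
      rw [zpow_one] at this
      rw [this]
      exact Matrix.one_add_smul_labelShift_mem _ _ _ _
    | inv_of x _ =>
      have := hφ x (-1)
      rw [zpow_neg_one] at this
      rw [this]
      exact Matrix.one_add_smul_labelShift_mem _ _ _ _
    | mul x y hx hy => rw [_root_.map_mul, Units.val_mul]; exact mul_mem hx hy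
  · intro h
    have : l = [] := List.length_eq_zero_iff.1 (by simpa using (congrArg Fin.val h).symm)
    simp [this] at hg
  · have : (φ (l.map fun p => of p.1 ^ p.2).prod : Matrix _ _ ℤ) =
        (l.map fun p => 1 + p.2 • N p.1).prod := by
      rw [← Units.coeHom_apply, ← MonoidHom.comp_apply, map_list_prod, List.map_map]
      congr 1
      exact List.map_congr_left fun p _ => hφ p.1 p.2
    rw [this, Matrix.prod_one_add_labelShift_apply c l 0 (Fin.last _) (by simp)
      (fun k hk => by simp [c, hk])]
    exact List.prod_ne_zero (by simpa using fun a h => hl0 (a, 0) h rfl)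

theorem Nat.div_gcd_factorial_dvd_choose {n q k : ℕ} (hk : k ≠ 0) (hkn : k ≤ n) :
    q / q.gcd n.factorial ∣ q.choose k := by
  obtain ⟨k, rfl⟩ := Nat.exists_eq_succ_of_ne_zero hk
  cases q with
  | zero => simp
  | succ q =>
    have h₁ : q + 1 ∣ n.factorial * (q + 1).choose (k + 1) := by
      refine dvd_trans ?_ (mul_dvd_mul_right
        (Nat.dvd_factorial (Nat.succ_pos k) hkn) _)
      rw [mul_comm, ← Nat.add_one_mul_choose_eq]
      exact dvd_mul_right _ _
    have h₂ := Nat.coprime_div_gcd_div_gcd (Nat.gcd_pos_of_pos_left (n.factorial) q.succ_pos)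
    refine h₂.dvd_of_dvd_mul_left ?_
    rw [Nat.div_mul_right_comm (Nat.gcd_dvd_right _ _)]
    exact Nat.div_dvd_div (Nat.gcd_dvd_left _ _) h₁

/-- A unipotent element has trivial `q`-th power modulo a divisor of `q` of bounded index. -/
theorem pow_eq_one_of_sub_one_pow_eq_zero {R : Type*} [Ring R] {d n q : ℕ} [CharP R d]
    (hd : d = q / q.gcd n.factorial) {a : R} (ha : (a - 1) ^ (n + 1) = 0) : a ^ q = 1 := by
  rw [← sub_add_cancel a 1, (Commute.one_right (a - 1)).add_pow,
    Finset.sum_eq_single 0]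
  · simp
  · intro k _ hk
    by_cases hkn : k ≤ n
    · rw [(CharP.cast_eq_zero_iff R d _).2 (hd ▸ Nat.div_gcd_factorial_dvd_choose hk hkn), mul_zero]
    · rw [pow_eq_zero_of_le (by lia) ha, zero_mul, zero_mul]
  · simp

/-- A nontrivial element of a free group survives in some finite quotient of exponent dividing `q`,
for all large `q`. -/
theorem FreeGroup.exists_finiteIndex_pow_mem {α : Type*} {g : FreeGroup α} (hg : g ≠ 1) :
    ∃ M : ℕ, ∀ q : ℕ, M ≤ q → ∃ N : Subgroup (FreeGroup α), N.Normal ∧ N.FiniteIndex ∧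
      g ∉ N ∧ ∀ h, h ^ q ∈ N := by
  obtain ⟨n, φ, hφ, i, j, hij, hgij⟩ := exists_unitriangular_rep hg
  set b := ((φ g : Matrix _ _ ℤ) i j).natAbs
  refine ⟨n.factorial * (b + 1), fun q hq => ?_⟩
  have hn := n.factorial_pos
  have hgcd : q.gcd n.factorial ≤ n.factorial := Nat.gcd_le_right _ hn
  have hgcd0 : 0 < q.gcd n.factorial := Nat.gcd_pos_of_pos_right _ hn
  obtain ⟨d, hd⟩ : ∃ d, d = q / q.gcd n.factorial := ⟨_, rfl⟩
  have hbd : b < d := by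
    rw [hd, ← Nat.add_one_le_iff, Nat.le_div_iff_mul_le hgcd0, mul_comm]
    exact (Nat.mul_le_mul_right _ hgcd).trans hq
  have : NeZero d := ⟨by lia⟩
  let ρ := (Int.castRingHom (ZMod d)).mapMatrix (m := Fin (n + 1))
  let ψ := (Units.map (ρ : _ →* Matrix (Fin (n + 1)) (Fin (n + 1)) (ZMod d))).comp φ
  refine ⟨ψ.ker, inferInstance, inferInstance, fun h => hgij ?_, fun h => ?_⟩
  · have h₁ : ρ (φ g) = 1 := congrArg Units.val (MonoidHom.mem_ker.1 h)
    have h₂ : (((φ g : Matrix _ _ ℤ) i j : ℤ) : ZMod d) = 0 := by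
      simpa [ρ, hij] using congrFun (congrFun h₁ i) j
    rw [ZMod.intCast_zmod_eq_zero_iff_dvd] at h₂
    exact Int.eq_zero_of_dvd_of_natAbs_lt_natAbs h₂ (by simpa using hbd)
  · rw [MonoidHom.mem_ker, map_pow]
    ext1
    rw [Units.val_pow_eq_pow_val, Units.val_one]
    refine pow_eq_one_of_sub_one_pow_eq_zero (d := d) (n := n) hd ?_
    have h₁ := congrArg ρ (Matrix.sub_one_pow_card_eq_zero (hφ h))
    rw [map_pow, map_sub, _root_.map_one, map_zero, Fintype.card_fin] at h₁
    exact h₁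

/-- For nontrivial elements g₁,…,g_k of a free group F and m ∈ ℕ, there is
M ∈ ℕ such that for every q ≥ M there is a finite index normal subgroup N of F with:
for all i, g_iˢ ∉ N whenever 1 ≤ s ≤ m, but g_i^q ∈ N. -/
theorem stmt_3 {α : Type*} (k : ℕ) (g : Fin k → FreeGroup α) (hg : ∀ i, g i ≠ 1) (m : ℕ) :
    ∃ M : ℕ, ∀ q : ℕ, M ≤ q →
      ∃ N : Subgroup (FreeGroup α), N.Normal ∧ N.FiniteIndex ∧
        ∀ i : Fin k, (∀ s : ℕ, 1 ≤ s → s ≤ m → (g i) ^ s ∉ N) ∧ (g i) ^ q ∈ N := by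
  have hne : ∀ p : Fin k × Fin m, g p.1 ^ (p.2.val + 1) ≠ 1 := fun p =>
    fun h => hg p.1 ((pow_eq_one_iff_left (Nat.succ_ne_zero _)).1 h)
  choose M hM using fun p => FreeGroup.exists_finiteIndex_pow_mem (hne p)
  refine ⟨∑ p, M p, fun q hq => ?_⟩
  choose N hN hfin hmem hpow using fun p => hM p q
    ((Finset.single_le_sum (fun _ _ => Nat.zero_le _) (Finset.mem_univ p)).trans hq)
  refine ⟨⨅ p, N p, Subgroup.normal_iInf_normal hN, Subgroup.finiteIndex_iInf hfin, fun i =>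
    ⟨fun s hs hsm h => ?_, Subgroup.mem_iInf.2 fun p => hpow p _⟩⟩
  apply hmem (i, ⟨s - 1, by lia⟩)
  simpa [Nat.sub_add_cancel hs] using Subgroup.mem_iInf.1 h (i, ⟨s - 1, by lia⟩)
end

section
/- Let F be a free group of rank r ≥ 2, n ≥ 2, and suppose G is a group admitting a presentation with n generators and at most n−2 relations. Then G has a finite index subgroup that surjects onto a nonabelian free group (i.e., G is large). -/
/-- A group is large if some finite index subgroup surjects onto a noncyclic free group. -/
def IsLarge (G : Type*) [Group G] : Prop :=
  ∃ H : Subgroup G, H.FiniteIndex ∧ ∃ φ : H →* FreeGroup (Fin 2), Function.Surjective φ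

/-- Over `ℤ`, fewer vectors than coordinates are killed by a common functional whose values
on the standard basis generate `ℤ`. -/
theorem exists_addMonoidHom_apply_eq_zero_and_closure_eq_top {ι κ : Type*} [Fintype ι]
    [DecidableEq ι] [Fintype κ] (v : κ → ι → ℤ) (h : Fintype.card κ < Fintype.card ι) :
    ∃ f : (ι → ℤ) →+ ℤ, (∀ j, f (v j) = 0) ∧
      AddSubgroup.closure (Set.range fun i => f (Pi.single i 1)) = ⊤ := by
  obtain ⟨y, hy0, hy⟩ : ∃ y : ι → ℤ, y ≠ 0 ∧ ∀ j, ∑ i, v j i * y i = 0 := by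
    by_contra! hcon
    refine absurd (card_le_of_injective ℤ (Matrix.mulVecLin (Matrix.of v)) ?_) (not_le.2 h)
    rw [injective_iff_map_eq_zero]
    intro y hy
    by_contra hy0
    obtain ⟨j, hj⟩ := hcon y hy0
    exact hj (congrFun hy j)
  obtain ⟨g, hg⟩ := Int.subgroup_cyclic (AddSubgroup.closure (Set.range y))
  have hdvd : ∀ i, ∃ z, y i = g * z := fun i => by
    have : y i ∈ AddSubgroup.closure {g} :=
      hg ▸ AddSubgroup.subset_closure (Set.mem_range_self i)
    obtain ⟨z, hz⟩ := AddSubgroup.mem_closure_singleton.1 this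
    exact ⟨z, by rw [← hz, smul_eq_mul, mul_comm]⟩
  choose z hz using hdvd
  have hg0 : g ≠ 0 := by
    rintro rfl
    exact hy0 (funext fun i => by simpa using hz i)
  let f : (ι → ℤ) →+ ℤ :=
    { toFun := fun x => ∑ i, x i * z i
      map_zero' := by simp
      map_add' := fun a b => by simp [add_mul, Finset.sum_add_distrib] }
  have hf : ∀ i, f (Pi.single i 1) = z i := fun i => by simp [f, Pi.single_apply]
  refine ⟨f, fun j => ?_, ?_⟩
  · have : g * f (v j) = 0 := by
      rw [← hy j]
      simp only [f, AddMonoidHom.coe_mk, ZeroHom.coe_mk, Finset.mul_sum, hz]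
      exact Finset.sum_congr rfl fun i _ => by ring
    exact (mul_eq_zero.1 this).resolve_left hg0
  · simp only [hf]
    have hmap : (AddSubgroup.closure (Set.range z)).map (AddMonoidHom.mulLeft g)
        = AddSubgroup.closure (Set.range y) := by
      rw [AddMonoidHom.map_closure, ← Set.range_comp]
      congr 2
      exact funext fun i => (hz i).symm
    have hmem : g ∈ (AddSubgroup.closure (Set.range z)).map (AddMonoidHom.mulLeft g) := by
      rw [hmap, hg]
      exact AddSubgroup.subset_closure rfl
    obtain ⟨t, ht, htg⟩ := hmem
    have ht1 : t = 1 := mul_left_cancel₀ hg0 (by simpa using htg)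
    subst ht1
    rw [eq_top_iff]
    intro m _
    simpa using AddSubgroup.zsmul_mem _ ht m

open Multiplicative in
/-- A free group on more generators than `rels` has relators has a surjection onto `ℤ` killing
`rels`. -/
theorem FreeGroup.exists_surjective_int {α : Type*} [Fintype α] (rels : Set (FreeGroup α))
    (hfin : rels.Finite) (hcard : rels.ncard < Fintype.card α) :
    ∃ χ : FreeGroup α →* Multiplicative ℤ, Function.Surjective χ ∧ ∀ r ∈ rels, χ r = 1 := by
  classical
  have := hfin.fintype
  let ab : FreeGroup α →* Multiplicative (α → ℤ) :=
    FreeGroup.lift fun i => ofAdd (Pi.single i 1)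
  obtain ⟨f, hf, htop⟩ := exists_addMonoidHom_apply_eq_zero_and_closure_eq_top
    (fun r : rels => toAdd (ab r)) (by rwa [← Nat.card_eq_fintype_card, Nat.card_coe_set_eq])
  refine ⟨(AddMonoidHom.toMultiplicative f).comp ab, ?_, fun r hr => ?_⟩
  · rw [← MonoidHom.range_eq_top]
    set χ := (AddMonoidHom.toMultiplicative f).comp ab
    have hle : AddSubgroup.closure (Set.range fun i => f (Pi.single i 1))
        ≤ Subgroup.toAddSubgroup' χ.range := by
      rw [AddSubgroup.closure_le]
      rintro _ ⟨i, rfl⟩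
      exact ⟨FreeGroup.of i, by simp [χ, ab]; rfl⟩
    rw [htop] at hle
    exact eq_top_iff.2 fun m _ => hle (AddSubgroup.mem_top (toAdd m))
  · exact congrArg ofAdd (hf ⟨r, hr⟩)

namespace RegularWreathProduct

open Multiplicative

variable {C : Type*}

/-- The value at the integer `k` of the base component of an element of `C ≀ᵣ ℤ`. -/
def val (a : C ≀ᵣ Multiplicative ℤ) (k : ℤ) : C := a.left (ofAdd k)

/-- The `ℤ`-component of an element of `C ≀ᵣ ℤ`. -/
def shift (a : C ≀ᵣ Multiplicative ℤ) : ℤ := toAdd a.right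

theorem ext_val {a b : C ≀ᵣ Multiplicative ℤ} (h : ∀ k, a.val k = b.val k)
    (h' : a.shift = b.shift) : a = b :=
  RegularWreathProduct.ext (funext fun k => h (toAdd k)) h'

variable [Group C]

@[simp] theorem val_one (k : ℤ) : (1 : C ≀ᵣ Multiplicative ℤ).val k = 1 := rfl

@[simp] theorem shift_one : (1 : C ≀ᵣ Multiplicative ℤ).shift = 0 := rfl

@[simp] theorem shift_mul (a b : C ≀ᵣ Multiplicative ℤ) :
    (a * b).shift = a.shift + b.shift := rfl

theorem val_mul (a b : C ≀ᵣ Multiplicative ℤ) (k : ℤ) :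
    (a * b).val k = a.val k * b.val (k - a.shift) := by
  rw [sub_eq_neg_add]; rfl

theorem val_inv (a : C ≀ᵣ Multiplicative ℤ) (k : ℤ) :
    a⁻¹.val k = (a.val (k + a.shift))⁻¹ := by
  rw [add_comm]; rfl

@[simp] theorem val_inl (q : Multiplicative ℤ) (k : ℤ) :
    (inl q : C ≀ᵣ Multiplicative ℤ).val k = 1 := rfl

@[simp] theorem shift_inl (q : Multiplicative ℤ) :
    (inl q : C ≀ᵣ Multiplicative ℤ).shift = toAdd q := rfl

/-- The homomorphism from a free group to `C ≀ᵣ ℤ` over `χ` whose base components on generators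
are given by `Y`. -/
def liftOver {α : Type*} (χ : FreeGroup α →* Multiplicative ℤ) (Y : α → ℤ → C) :
    FreeGroup α →* C ≀ᵣ Multiplicative ℤ :=
  FreeGroup.lift fun i => ⟨fun k => Y i (toAdd k), χ (FreeGroup.of i)⟩

variable {α : Type*} (χ : FreeGroup α →* Multiplicative ℤ)

@[simp] theorem val_liftOver_of (Y : α → ℤ → C) (i : α) (k : ℤ) :
    (liftOver χ Y (FreeGroup.of i)).val k = Y i k := by
  simp [liftOver, val]

@[simp] theorem shift_liftOver (Y : α → ℤ → C) (w : FreeGroup α) :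
    (liftOver χ Y w).shift = toAdd (χ w) := by
  have : rightHom.comp (liftOver χ Y) = χ := by ext; simp [liftOver]
  exact congrArg toAdd (DFunLike.congr_fun this w)

/-- The base component of `liftOver χ Y w` at `k` depends only on the values of `Y` on a window
around `k` whose size depends only on `w`, naturally in the group of values and equivariantly
under translation. -/
theorem exists_val_liftOver_eq (w : FreeGroup α) :
    ∃ L : ℕ, ∀ {A C : Type} [Group A] [Group C] (θ : A →* C) (Y : α → ℤ → C) (c : α → ℤ → A)
      (k p : ℤ), (∀ i j, |j - k| ≤ L → Y i (j + p) = θ (c i j)) →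
        (liftOver χ Y w).val (k + p) = θ ((liftOver χ c w).val k) := by
  induction w using FreeGroup.induction_on with
  | C1 => exact ⟨0, fun θ Y c k p _ => by simp⟩
  | of i =>
    refine ⟨0, fun θ Y c k p h => ?_⟩
    simpa using h i k (by simp)
  | inv_of i ih =>
    refine ⟨(toAdd (χ (FreeGroup.of i))).natAbs, fun θ Y c k p h => ?_⟩
    have := h i (k + toAdd (χ (FreeGroup.of i))) (by simp)
    rw [map_inv, map_inv, val_inv, val_inv, map_inv]
    simp only [shift_liftOver, val_liftOver_of, inv_inj]
    rw [← this]
    congr 1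
    ring
  | mul a b iha ihb =>
    obtain ⟨La, hLa⟩ := iha
    obtain ⟨Lb, hLb⟩ := ihb
    refine ⟨La + Lb + (toAdd (χ a)).natAbs, fun θ Y c k p h => ?_⟩
    rw [map_mul, map_mul, val_mul, val_mul, map_mul, shift_liftOver, shift_liftOver,
      hLa θ Y c k p fun i j hj => h i j (by rw [abs_le] at hj ⊢; lia),
      show k + p - toAdd (χ a) = k - toAdd (χ a) + p by ring,
      hLb θ Y c _ p fun i j hj => h i j (by rw [abs_le] at hj ⊢; lia)]

/-- `liftOver χ Y` inherits twisted periodicity from `Y`. -/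
theorem val_liftOver_add {C : Type} [Group C] (Y : α → ℤ → C) (s : C) (p : ℤ)
    (h : ∀ i k, Y i (k + p) = s * Y i k * s⁻¹) (w : FreeGroup α) (k : ℤ) :
    (liftOver χ Y w).val (k + p) = s * (liftOver χ Y w).val k * s⁻¹ := by
  obtain ⟨L, hL⟩ := exists_val_liftOver_eq χ w
  exact hL (MulAut.conj s).toMonoidHom Y Y k p fun i j _ => by simpa using h i j

end RegularWreathProduct

open Multiplicative RegularWreathProduct

/-- A homomorphism to `FreeGroup (Fin 2) ≀ᵣ ℤ` with `d`-periodic base components, up to conjugation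
by the first generator, whose image contains the standard copy of `ℤ` and base
elements with value at `0` generating the powers of the second generator, witnesses largeness. -/
theorem isLarge_of_wreath {G : Type*} [Group G] (Φ : G →* FreeGroup (Fin 2) ≀ᵣ Multiplicative ℤ)
    (d : ℕ) (hd : 0 < d)
    (hper : ∀ g k (q : ℤ), (Φ g).val (k + q * d) =
      FreeGroup.of 0 ^ q * (Φ g).val k * (FreeGroup.of 0 ^ q)⁻¹)
    (T : G) (hT : Φ T = inl (ofAdd 1)) {ι : Type*} (z : ι → ℤ)
    (hz : AddSubgroup.closure (Set.range z) = ⊤)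
    (hU : ∀ i, ∃ g, (Φ g).shift = 0 ∧ (Φ g).val 0 = FreeGroup.of 1 ^ z i) : IsLarge G := by
  have : NeZero d := ⟨hd.ne'⟩
  let π : G →* Multiplicative (ZMod d) :=
    (AddMonoidHom.toMultiplicative (Int.castAddHom (ZMod d))).comp (rightHom.comp Φ)
  have hmem : ∀ g, g ∈ π.ker ↔ (d : ℤ) ∣ (Φ g).shift := fun g =>
    Iff.trans Iff.rfl (ZMod.intCast_zmod_eq_zero_iff_dvd (Φ g).shift d)
  have hd0 : (d : ℤ) ≠ 0 := by exact_mod_cast hd.ne'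
  let φ : π.ker →* FreeGroup (Fin 2) := MonoidHom.mk'
    (fun h => (Φ h).val 0 * (FreeGroup.of 0 ^ ((Φ h).shift / (d : ℤ)))⁻¹) (by
      rintro ⟨a, ha⟩ ⟨b, hb⟩
      rw [hmem] at ha hb
      obtain ⟨p, hp⟩ := ha
      obtain ⟨q, hq⟩ := hb
      have h1 := hper b 0 (-p)
      simp only [MulMemClass.mk_mul_mk, map_mul, val_mul, shift_mul, hp, hq, ← mul_add,
        Int.mul_ediv_cancel_left _ hd0]
      rw [show (0 : ℤ) - d * p = 0 + -p * d by ring, h1]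
      group)
  refine ⟨π.ker, inferInstance, φ, ?_⟩
  rw [← MonoidHom.range_eq_top]
  have hs : FreeGroup.of 0 ∈ φ.range := by
    have hTd : Φ (T ^ d) = inl (ofAdd (d : ℤ)) := by
      rw [map_pow, hT, ← map_pow, ← ofAdd_nsmul]
      simp
    refine (inv_mem_iff (H := φ.range)).1 ⟨⟨T ^ d, (hmem _).2 (by simp [hTd])⟩, ?_⟩
    simp [φ, hTd, Int.ediv_self hd0]
  have hu : FreeGroup.of 1 ∈ φ.range := by
    have hle : AddSubgroup.closure (Set.range z) ≤
        Subgroup.toAddSubgroup' (φ.range.comap (zpowersHom _ (FreeGroup.of 1))) := by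
      rw [AddSubgroup.closure_le]
      rintro _ ⟨i, rfl⟩
      obtain ⟨g, hg, hg'⟩ := hU i
      exact ⟨⟨g, (hmem _).2 (by simp [hg])⟩, by simp [φ, hg, hg']; rfl⟩
    rw [hz] at hle
    simpa using hle (AddSubgroup.mem_top (1 : ℤ))
  rw [eq_top_iff, ← FreeGroup.closure_range_of, Subgroup.closure_le]
  rintro _ ⟨i, rfl⟩
  fin_cases i
  exacts [hs, hu]

theorem IsLarge.of_mulEquiv {G K : Type*} [Group G] [Group K] (e : G ≃* K) (h : IsLarge K) :
    IsLarge G := by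
  obtain ⟨H, hH, φ, hφ⟩ := h
  refine ⟨H.comap e.toMonoidHom,
    ⟨(H.index_comap_of_surjective e.surjective).trans_ne hH.index_ne_zero⟩,
    φ.comp (e.toMonoidHom.subgroupComap H),
    hφ.comp fun x => ⟨⟨e.symm x, by simp⟩, Subtype.ext (e.apply_symm_apply x)⟩⟩

/-- If finitely many elements of the free group on `α` number fewer than the generators, then for
some `d` there is a twisted `d`-periodic family `Y` in `FreeGroup (Fin 2)` such that `liftOver χ Y`
has trivial base components on all of them, while the values of `Y` are powers of the second
generator whose exponents generate `ℤ`. -/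
theorem exists_periodic_family {α : Type} [Fintype α] (χ : FreeGroup α →* Multiplicative ℤ)
    (R : Set (FreeGroup α)) (hfin : R.Finite) (hcard : R.ncard < Fintype.card α) :
    ∃ (d : ℕ) (Y : α → ℤ → FreeGroup (Fin 2)) (ι : Type) (z : ι → ℤ), 0 < d ∧
      (∀ i k (q : ℤ), Y i (k + q * d) = FreeGroup.of 0 ^ q * Y i k * (FreeGroup.of 0 ^ q)⁻¹) ∧
      (∀ r ∈ R, ∀ k, (liftOver χ Y r).val k = 1) ∧
      AddSubgroup.closure (Set.range z) = ⊤ ∧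
      ∀ a, ∃ i k, Y i k = FreeGroup.of 1 ^ z a := by
  classical
  have := hfin.fintype
  choose len hlen using exists_val_liftOver_eq (α := α) χ
  obtain ⟨L, hL⟩ : ∃ L, ∀ r ∈ R, len r ≤ L :=
    ⟨hfin.toFinset.sup len, fun r hr => Finset.le_sup (hfin.mem_toFinset.2 hr)⟩
  set N := Fintype.card α with hN
  have hRN : Fintype.card R < N := by rwa [← Nat.card_eq_fintype_card, Nat.card_coe_set_eq]
  obtain ⟨e, he⟩ : ∃ e, e = 2 * L * N + 1 := ⟨_, rfl⟩
  have hNe : 2 * L < e := by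
    have : 1 ≤ N := by lia
    nlinarith
  let d := 2 * L + e
  let c : α → ℤ → Multiplicative (α × Fin e → ℤ) := fun i k =>
    if h : 0 ≤ k - 2 * L ∧ k - 2 * L < e then
      ofAdd (Pi.single (i, ⟨(k - 2 * L).toNat, by lia⟩) 1) else 1
  obtain ⟨f, hf, hz⟩ := exists_addMonoidHom_apply_eq_zero_and_closure_eq_top
    (fun x : R × Fin d => toAdd ((liftOver χ c x.1).val (L + (x.2 : ℕ)))) (by
      simp only [Fintype.card_prod, Fintype.card_fin, d, ← hN]
      have : Fintype.card R * (2 * L + e) ≤ (N - 1) * (2 * L + e) :=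
        Nat.mul_le_mul_right _ (by lia)
      obtain ⟨M, hM⟩ : ∃ M, N = M + 1 := ⟨N - 1, by lia⟩
      rw [hM] at he this ⊢
      simp only [Nat.add_sub_cancel] at this
      nlinarith)
  let θ : Multiplicative (α × Fin e → ℤ) →* FreeGroup (Fin 2) :=
    (zpowersHom _ (FreeGroup.of 1)).comp (AddMonoidHom.toMultiplicative f)
  let Y : α → ℤ → FreeGroup (Fin 2) := fun i k =>
    FreeGroup.of 0 ^ (k / d) * θ (c i (k % d)) * (FreeGroup.of 0 ^ (k / d))⁻¹
  have hd : 0 < d := by lia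
  have hd0 : (d : ℤ) ≠ 0 := by lia
  have hYper : ∀ i k (q : ℤ),
      Y i (k + q * d) = FreeGroup.of 0 ^ q * Y i k * (FreeGroup.of 0 ^ q)⁻¹ := fun i k q => by
    simp only [Y, Int.add_mul_ediv_right _ _ hd0, Int.add_mul_emod_self_right]
    rw [add_comm, zpow_add]
    group
  have hYc : ∀ i (k : ℤ), 0 ≤ k → k < d + 2 * L → Y i k = θ (c i k) := fun i k h0 h1 => by
    rcases lt_or_ge k d with hk | hk
    · simp [Y, Int.ediv_eq_zero_of_lt h0 hk, Int.emod_eq_of_lt h0 hk]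
    · obtain ⟨j, rfl⟩ : ∃ j, k = j + 1 * (d : ℤ) := ⟨k - d, by ring⟩
      have hj : c i j = 1 := dif_neg (by lia)
      have hj' : c i (j + 1 * (d : ℤ)) = 1 := dif_neg (by push_cast [d]; lia)
      rw [hYper, hj', show Y i j = θ (c i j) by
        simp [Y, Int.ediv_eq_zero_of_lt (a := j) (b := d) (by lia) (by lia),
          Int.emod_eq_of_lt (a := j) (b := d) (by lia) (by lia)], hj]
      simp
  refine ⟨d, Y, α × Fin e, _, hd, hYper, fun r hr k => ?_, hz, fun ⟨i, j⟩ => ?_⟩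
  · have hwin : ∀ j, 0 ≤ j → j < (d : ℤ) → (liftOver χ Y r).val (L + j) = 1 := fun j h0 h1 => by
      have hv := hf (⟨r, hr⟩, ⟨j.toNat, by lia⟩)
      have hLr := hL r hr
      have := hlen r θ Y c (L + j) 0 fun i l hl => by
        rw [abs_le] at hl
        rw [add_zero]
        exact hYc i l (by lia) (by lia)
      rw [add_zero] at this
      rw [this]
      simp only [Int.toNat_of_nonneg h0] at hv
      simp only [θ, MonoidHom.comp_apply, AddMonoidHom.toMultiplicative_apply_apply, hv, ofAdd_zero,
        map_one]
    have hk : k = L + (k - L) % d + (k - L) / d * d := by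
      have := Int.emod_add_ediv_mul (k - L) d
      lia
    rw [hk, val_liftOver_add χ Y _ _ (fun i k => hYper i k _),
      hwin _ (Int.emod_nonneg _ hd0) (Int.emod_lt_of_pos _ (by lia))]
    simp
  · have hj := j.isLt
    refine ⟨i, 2 * L + (j : ℕ), ?_⟩
    rw [hYc i _ (by lia) (by push_cast [d]; lia)]
    have hc : c i (2 * L + (j : ℕ)) = ofAdd (Pi.single (i, j) 1) := by
      simp [c]
    simp [hc, θ]

/-- Baumslag–Pride: a group admitting a presentation with n ≥ 2 generators
and at most n−2 relations is large. -/
theorem stmt_6 {G : Type*} [Group G] (n : ℕ) (hn : 2 ≤ n)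
    (rels : Set (FreeGroup (Fin n))) (hfin : rels.Finite) (hcard : rels.ncard ≤ n - 2)
    (e : G ≃* PresentedGroup rels) :
    IsLarge G := by
  refine IsLarge.of_mulEquiv e ?_
  obtain ⟨χ, hχ, hrels⟩ := FreeGroup.exists_surjective_int rels hfin
    (by rw [Fintype.card_fin]; lia)
  obtain ⟨W, hW⟩ := hχ (ofAdd 1)
  obtain ⟨d, Y, ι, z, hd, hper, hone, hz, hY⟩ := exists_periodic_family χ (insert W rels)
    (hfin.insert W) (by
      have := Set.ncard_insert_le W rels
      rw [Fintype.card_fin]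
      lia)
  have hkill : ∀ r ∈ rels, liftOver χ Y r = 1 := fun r hr =>
    ext_val (fun k => by rw [hone r (Or.inr hr) k, val_one]) (by simp [hrels r hr])
  have hWinl : liftOver χ Y W = inl (ofAdd 1) :=
    ext_val (fun k => by rw [hone W (Or.inl rfl) k, val_inl]) (by simp [hW])
  let Φ : PresentedGroup rels →* FreeGroup (Fin 2) ≀ᵣ Multiplicative ℤ :=
    PresentedGroup.toGroup (rels := rels) hkill
  have hΦ : ∀ w, Φ (PresentedGroup.mk rels w) = liftOver χ Y w := fun w => rfl
  refine isLarge_of_wreath Φ d hd (fun g k q => ?_) (PresentedGroup.mk rels W)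
    ((hΦ W).trans hWinl) z hz fun a => ?_
  · obtain ⟨w, rfl⟩ := PresentedGroup.mk_surjective rels g
    rw [hΦ]
    exact val_liftOver_add χ Y _ _ (fun i k => hper i k q) w k
  · obtain ⟨i, k, hik⟩ := hY a
    have hWpow : ∀ m : ℤ, liftOver χ Y (W ^ m) = inl (ofAdd m) := fun m => by
      rw [map_zpow, hWinl, ← map_zpow, ← ofAdd_zsmul, smul_eq_mul, mul_one]
    refine ⟨PresentedGroup.mk rels
      (W ^ (-k) * FreeGroup.of i * W ^ (k - toAdd (χ (FreeGroup.of i)))), ?_, ?_⟩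
    · rw [hΦ, map_mul, map_mul, hWpow, hWpow]
      simp only [shift_mul, shift_inl, shift_liftOver, toAdd_ofAdd]
      ring
    · rw [hΦ, map_mul, map_mul, hWpow, hWpow, val_mul, val_mul]
      simp only [val_inl, shift_inl, toAdd_ofAdd, val_liftOver_of, sub_neg_eq_add, zero_add, hik,
        one_mul, mul_one]
end

section
/- Let F be a free group of rank r ≥ 2 and g₁, …, g_k arbitrary elements of F. Then the quotient F/⟪g₁^q, …, g_k^q⟫ (the quotient by the normal closure of the q-th powers) is large for all but finitely many q ∈ ℕ. -/
section FiniteQuotients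

open Polynomial

/-- The unit `1 + N` attached to an element `N` of square zero. -/
def oneAddUnit {A : Type*} [Ring A] (N : A) (hN : N * N = 0) : Aˣ where
  val := 1 + N
  inv := 1 - N
  val_inv := by rw [add_mul, mul_sub, mul_sub, hN]; simp
  inv_val := by rw [sub_mul, mul_add, mul_add, hN]; simp

lemma oneAddUnit_zpow {A : Type*} [Ring A] (N : A) (hN : N * N = 0) (n : ℤ) :
    ((oneAddUnit N hN ^ n : Aˣ) : A) = 1 + n • N := by
  induction n using Int.induction_on with
  | zero => simp
  | succ k ih =>
    rw [zpow_add_one, Units.val_mul, ih]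
    simp only [oneAddUnit, mul_add, add_mul, smul_mul_assoc, hN, add_smul]
    simp
    abel
  | pred k ih =>
    rw [zpow_sub_one, Units.val_mul, ih]
    change (1 + (-(k : ℤ)) • N) * (1 - N) = _
    simp only [mul_sub, add_mul, smul_mul_assoc, hN, sub_smul]
    simp
    abel

/-- The rank one matrix sending `(x, y)` to `t (y - c x) (1, c)`. -/
def parabolicPart {S : Type*} [CommRing S] (t c : S) : Matrix (Fin 2) (Fin 2) S :=
  !![-(t * c), t; -(t * c * c), t * c]

lemma parabolicPart_mul_self {S : Type*} [CommRing S] (t c : S) :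
    parabolicPart t c * parabolicPart t c = 0 := by
  ext i j
  fin_cases i <;> fin_cases j <;> simp [parabolicPart, Matrix.mul_apply, Fin.sum_univ_two] <;> ring

/-- The representation of the free group sending the `i`-th generator to the transvection
fixing `(1, i)` with parameter `t`. -/
def parabolicRep (r : ℕ) {S : Type*} [CommRing S] (t : S) :
    FreeGroup (Fin r) →* (Matrix (Fin 2) (Fin 2) S)ˣ :=
  FreeGroup.lift fun i =>
    oneAddUnit (parabolicPart t ((i : ℕ) : S)) (parabolicPart_mul_self t _)

lemma parabolicRep_map (r : ℕ) {S S' : Type*} [CommRing S] [CommRing S'] (f : S →+* S') (t : S)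
    (w : FreeGroup (Fin r)) :
    (parabolicRep r (f t) w : Matrix (Fin 2) (Fin 2) S') =
      f.mapMatrix (parabolicRep r t w : Matrix (Fin 2) (Fin 2) S) := by
  have : parabolicRep r (f t) =
      (Units.map (f.mapMatrix (m := Fin 2)).toMonoidHom).comp
        (parabolicRep r t) := by
    ext i a b
    fin_cases a <;> fin_cases b <;> simp [parabolicRep, oneAddUnit, parabolicPart]
  rw [this]
  rfl

lemma exists_parabolicRep_eq (r : ℕ) {S : Type*} [CommRing S] (t : S) (w : FreeGroup (Fin r)) :
    ∃ B : Matrix (Fin 2) (Fin 2) S,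
      (parabolicRep r t w : Matrix (Fin 2) (Fin 2) S) = 1 + t • B := by
  induction w using FreeGroup.induction_on with
  | C1 => exact ⟨0, by simp⟩
  | of i =>
    refine ⟨parabolicPart 1 ((i : ℕ) : S), ?_⟩
    simp [parabolicRep, oneAddUnit, parabolicPart, mul_assoc]
  | inv_of i _ =>
    refine ⟨-parabolicPart 1 ((i : ℕ) : S), ?_⟩
    have : parabolicRep r t (FreeGroup.of i)⁻¹ =
      (oneAddUnit (parabolicPart t ((i : ℕ) : S)) (parabolicPart_mul_self t _))⁻¹ := by
      simp [parabolicRep]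
    rw [this]
    change 1 - parabolicPart t ((i : ℕ) : S) = _
    simp [parabolicPart, sub_eq_add_neg, mul_assoc]
  | mul u v hu hv =>
    obtain ⟨B, hB⟩ := hu
    obtain ⟨C, hC⟩ := hv
    refine ⟨B + C + t • (B * C), ?_⟩
    rw [map_mul, Units.val_mul, hB, hC]
    simp only [mul_add, add_mul, one_mul, mul_one, smul_add, Algebra.smul_mul_assoc,
      Algebra.mul_smul_comm]
    abel

lemma parabolicRep_pow_eq_one (r : ℕ) {S : Type*} [CommRing S] (t : S) (n q : ℕ)
    (ht : t ^ (n + 1) = 0) (hq : ∀ j, 1 ≤ j → j ≤ n → ((q.choose j : ℕ) : S) = 0)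
    (w : FreeGroup (Fin r)) : parabolicRep r t w ^ q = 1 := by
  obtain ⟨B, hB⟩ := exists_parabolicRep_eq r t w
  ext1
  rw [Units.val_pow_eq_pow_val, hB, add_comm, (Commute.one_right _).add_pow, Units.val_one,
    Finset.sum_eq_single_of_mem 0 (by simp)]
  · simp
  · intro j _ hj
    rcases le_or_gt j n with h | h
    · rw [← map_natCast (algebraMap S (Matrix (Fin 2) (Fin 2) S)), hq j (by omega) h]
      simp
    · have : t ^ j = 0 := pow_eq_zero_of_le (by omega) ht
      simp [_root_.smul_pow, this]

lemma parabolicRep_injective {r : ℕ} (hr : 2 ≤ r) :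
    Function.Injective (parabolicRep r (X : ℤ[X])) := by
  have : Nontrivial (Fin r) := Fin.nontrivial_iff_two_le.mpr hr
  let E : (Matrix (Fin 2) (Fin 2) ℤ[X])ˣ →* (Module.End ℤ[X] (Fin 2 → ℤ[X]))ˣ :=
    Units.map (Matrix.toLinAlgEquiv' : Matrix (Fin 2) (Fin 2) ℤ[X] ≃ₐ[ℤ[X]] _).toMonoidHom
  let a : Fin r → (Matrix (Fin 2) (Fin 2) ℤ[X])ˣ := fun i =>
    oneAddUnit (parabolicPart X ((i : ℕ) : ℤ[X])) (parabolicPart_mul_self X _)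
  let f : ∀ _ : Fin r, FreeGroup Unit →* (Module.End ℤ[X] (Fin 2 → ℤ[X]))ˣ :=
    fun i => FreeGroup.lift fun _ => E (a i)
  have hsub : ∀ i j : Fin r, i ≠ j → ∀ u : Fin 2 → ℤ[X],
      (u 1 - ((j : ℕ) : ℤ[X]) * u 0).degree < (u 0).degree →
      (u 1 - ((i : ℕ) : ℤ[X]) * u 0).degree = (u 0).degree := by
    intro i j hij u hu
    have h0 : ((j : ℕ) : ℤ) - ((i : ℕ) : ℤ) ≠ 0 := by
      rw [sub_ne_zero]
      intro h
      exact hij (Fin.ext (by exact_mod_cast h.symm))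
    have h1 : u 1 - ((i : ℕ) : ℤ[X]) * u 0 =
        (u 1 - ((j : ℕ) : ℤ[X]) * u 0) + C (((j : ℕ) : ℤ) - ((i : ℕ) : ℤ)) * u 0 := by
      simp
      ring
    have h2 : (C (((j : ℕ) : ℤ) - ((i : ℕ) : ℤ)) * u 0).degree = (u 0).degree := by
      rw [degree_mul, degree_C h0, zero_add]
    rw [h1, degree_add_eq_right_of_degree_lt (by rwa [h2]), h2]
  have key : Function.Injective (Monoid.CoprodI.lift f) := by
    refine Monoid.CoprodI.lift_injective_of_ping_pong f (Or.inr ⟨⟨0, by omega⟩, ?_⟩)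
      (fun i => {u : Fin 2 → ℤ[X] | (u 1 - ((i : ℕ) : ℤ[X]) * u 0).degree < (u 0).degree}) ?_ ?_ ?_
    · rw [FreeGroup.freeGroupUnitEquivInt.cardinal_eq, Cardinal.mk_denumerable]
      exact Cardinal.natCast_le_aleph0
    · intro i
      refine ⟨![1, ((i : ℕ) : ℤ[X])], ?_⟩
      simp
    · intro i j hij
      refine Set.disjoint_left.mpr fun u hi hj => ?_
      simp only [Set.mem_ofPred_eq] at hi hj
      exact absurd hj (by rw [hsub j i hij.symm u hi]; exact lt_irrefl _)
    · intro i j hij h hh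
      obtain ⟨n, rfl⟩ : ∃ n : ℤ, h = FreeGroup.of () ^ n :=
        ⟨FreeGroup.freeGroupUnitEquivInt h, (FreeGroup.freeGroupUnitEquivInt.symm_apply_apply h).symm⟩
      have hn : n ≠ 0 := by rintro rfl; simp at hh
      rintro _ ⟨u, hu, rfl⟩
      simp only [Set.mem_ofPred_eq] at hu
      have hfn : f i (FreeGroup.of () ^ n) = E (a i ^ n) := by simp [f]
      have hact : ∀ u : Fin 2 → ℤ[X], (f i (FreeGroup.of () ^ n)) • u =
          Matrix.mulVec (1 + n • parabolicPart X ((i : ℕ) : ℤ[X])) u := by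
        intro u
        rw [hfn, ← oneAddUnit_zpow _ (parabolicPart_mul_self _ _)]
        rfl
      set c : ℤ[X] := ((i : ℕ) : ℤ[X]) with hc
      have h0 : (f i (FreeGroup.of () ^ n) • u) 0 = u 0 + C n * X * (u 1 - c * u 0) := by
        rw [hact]
        simp [Matrix.mulVec, dotProduct, Fin.sum_univ_two, parabolicPart]
        ring
      have h1 : (f i (FreeGroup.of () ^ n) • u) 1 - c * (f i (FreeGroup.of () ^ n) • u) 0 =
          u 1 - c * u 0 := by
        rw [hact]
        simp [Matrix.mulVec, dotProduct, Fin.sum_univ_two, parabolicPart]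
        ring
      have hd := hsub i j hij u hu
      have hu0 : u 0 ≠ 0 := by rintro h; simp [h] at hu
      have hdeg : (C n * X * (u 1 - c * u 0)).degree = (u 0).degree + 1 := by
        rw [degree_mul, degree_mul, degree_C hn, degree_X, hd, zero_add, add_comm]
      have hlt : (u 0).degree < (u 0).degree + 1 := by
        rw [degree_eq_natDegree hu0]
        exact_mod_cast Nat.lt_succ_self _
      simp only [Set.mem_ofPred_eq]
      rw [h1, hd, h0, degree_add_eq_right_of_degree_lt (by rw [hdeg]; exact hlt), hdeg]
      exact hlt
  have h : E.comp (parabolicRep r (X : ℤ[X])) =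
      (Monoid.CoprodI.lift f).comp (freeGroupEquivCoprodI (ι := Fin r)).toMonoidHom := by
    ext1 i
    simp [parabolicRep, f, a]
  have h2 : Function.Injective (E.comp (parabolicRep r (X : ℤ[X]))) := by
    rw [h]
    exact key.comp (MulEquiv.injective _)
  exact Function.Injective.of_comp (f := E) h2

lemma natCast_dvd_choose {n q j : ℕ} (h1 : 1 ≤ j) (hj : j ≤ n) :
    q / q.gcd n.factorial ∣ q.choose j := by
  rcases Nat.eq_zero_or_pos q with rfl | hq
  · simp [Nat.choose_eq_zero_of_lt (show 0 < j by omega)]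
  have h : q ∣ n.factorial * q.choose j := by
    have h2 : q ∣ j * q.choose j := by
      obtain ⟨q, rfl⟩ := Nat.exists_eq_succ_of_ne_zero hq.ne'
      obtain ⟨j, rfl⟩ := Nat.exists_eq_succ_of_ne_zero (show j ≠ 0 by omega)
      exact ⟨q.choose j, by rw [mul_comm]; exact (Nat.add_one_mul_choose_eq q j).symm⟩
    exact h2.trans (mul_dvd_mul_right (Nat.dvd_factorial (by omega) hj) _)
  have hg : 0 < q.gcd n.factorial := Nat.gcd_pos_of_pos_left _ hq
  refine (Nat.coprime_div_gcd_div_gcd hg).dvd_of_dvd_mul_left ?_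
  obtain ⟨c, hc⟩ := h
  refine ⟨c, Nat.eq_of_mul_eq_mul_left hg ?_⟩
  rw [← mul_assoc, ← mul_assoc, Nat.mul_div_cancel' (Nat.gcd_dvd_right _ _),
    Nat.mul_div_cancel' (Nat.gcd_dvd_left _ _), hc]

lemma exists_finite_quotient_exponent {r : ℕ} (hr : 2 ≤ r) (T : Finset (FreeGroup (Fin r)))
    (hT : 1 ∉ T) : ∃ q₀ : ℕ, ∀ q, q₀ < q → ∃ (P : Type) (_ : Group P) (_ : Finite P)
      (φ : FreeGroup (Fin r) →* P), (∀ w, φ w ^ q = 1) ∧ ∀ w ∈ T, φ w ≠ 1 := by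
  have hex : ∀ w : FreeGroup (Fin r), ∃ (a b : Fin 2) (e : ℕ), w ∈ T →
      ((parabolicRep r (X : ℤ[X]) w : Matrix _ _ _) a b - (1 : Matrix _ _ ℤ[X]) a b).coeff e ≠ 0 := by
    intro w
    by_contra! hw
    have hwT := (hw 0 0 0).1
    refine hT ?_
    have : parabolicRep r (X : ℤ[X]) w = parabolicRep r (X : ℤ[X]) 1 := by
      ext1
      ext1 a b
      rw [map_one, Units.val_one, ← sub_eq_zero]
      ext e
      simpa using (hw a b e).2
    rwa [← parabolicRep_injective hr this]
  choose a b e hcoeff using hex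
  let f : FreeGroup (Fin r) → ℤ[X] := fun w =>
    (parabolicRep r (X : ℤ[X]) w : Matrix _ _ _) (a w) (b w) - (1 : Matrix _ _ ℤ[X]) (a w) (b w)
  let n := T.sup e
  let D := T.sup fun w => ((f w).coeff (e w)).natAbs
  refine ⟨n.factorial * (D + 1), fun q hq => ?_⟩
  let M := q / q.gcd n.factorial
  have hq0 : 0 < q := by omega
  have hDM : D < M := by
    have h1 : q.gcd n.factorial ≤ n.factorial := Nat.gcd_le_right _ (Nat.factorial_pos n)
    have hg : 0 < q.gcd n.factorial := Nat.gcd_pos_of_pos_left _ hq0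
    refine (Nat.le_div_iff_mul_le hg).mpr ?_
    calc (D + 1) * q.gcd n.factorial ≤ (D + 1) * n.factorial := Nat.mul_le_mul_left _ h1
      _ ≤ q := by rw [mul_comm]; exact hq.le
  have : NeZero M := ⟨by omega⟩
  let I : Ideal (ZMod M)[X] := Ideal.span {X ^ (n + 1)}
  let S := (ZMod M)[X] ⧸ I
  have : Module.Finite (ZMod M) S := (monic_X_pow (n + 1)).finite_quotient
  have : Finite S := Module.finite_of_finite (ZMod M)
  let π : ℤ[X] →+* S := (Ideal.Quotient.mk I).comp (mapRingHom (Int.castRingHom (ZMod M)))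
  refine ⟨(Matrix (Fin 2) (Fin 2) S)ˣ, inferInstance, inferInstance, parabolicRep r (π X), ?_, ?_⟩
  · refine parabolicRep_pow_eq_one r _ n q ?_ ?_
    · rw [← map_pow]
      simp only [π, RingHom.comp_apply]
      rw [Ideal.Quotient.eq_zero_iff_mem]
      simp [I]
    · intro j h1 hj
      have h2 : ((q.choose j : ℕ) : ZMod M) = 0 :=
        (ZMod.natCast_eq_zero_iff _ _).mpr (natCast_dvd_choose h1 hj)
      rw [← map_natCast (algebraMap (ZMod M) S), h2, map_zero]
  · intro w hw h1
    have h2 := parabolicRep_map r π X w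
    rw [h1] at h2
    have h3 : π (f w) = 0 := by
      have := congrFun (congrFun h2 (a w)) (b w)
      simp only [f, map_sub]
      rw [RingHom.mapMatrix_apply, Matrix.map_apply] at this
      rw [← this, Matrix.one_apply, Units.val_one, Matrix.one_apply]
      split_ifs <;> simp
    simp only [π, RingHom.comp_apply] at h3
    rw [Ideal.Quotient.eq_zero_iff_mem, Ideal.mem_span_singleton, X_pow_dvd_iff] at h3
    have h4 := h3 (e w) (Nat.lt_succ_of_le (Finset.le_sup (f := e) hw))
    rw [coe_mapRingHom, coeff_map, eq_intCast, ZMod.intCast_zmod_eq_zero_iff_dvd] at h4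
    have h5 : ((f w).coeff (e w)).natAbs ≤ D :=
      Finset.le_sup (f := fun w => ((f w).coeff (e w)).natAbs) hw
    have h6 := Int.natAbs_dvd_natAbs.mpr h4
    have h7 := Nat.le_of_dvd (Int.natAbs_pos.mpr (hcoeff w hw)) h6
    rw [Int.natAbs_natCast] at h7
    exact (h7.trans h5).not_gt hDM

end FiniteQuotients

lemma IsLarge.of_surjective {G G' : Type*} [Group G] [Group G'] (f : G →* G')
    (hf : Function.Surjective f) (h : IsLarge G') : IsLarge G := by
  obtain ⟨H, hH, φ, hφ⟩ := h
  refine ⟨H.comap f, ⟨?_⟩, φ.comp (f.subgroupComap H), hφ.comp ?_⟩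
  · rw [H.index_comap_of_surjective hf]
    exact hH.index_ne_zero
  rintro ⟨y, hy⟩
  obtain ⟨x, rfl⟩ := hf y
  exact ⟨⟨x, hy⟩, rfl⟩

lemma FreeGroup.mem_zpowers_of_subsingleton {α : Type*} [Subsingleton α] :
    ∃ c : FreeGroup α, ∀ x, x ∈ Subgroup.zpowers c := by
  rcases isEmpty_or_nonempty α with h | ⟨⟨a⟩⟩
  · exact ⟨1, fun x => by rw [Subsingleton.elim x 1]; exact one_mem _⟩
  · refine ⟨FreeGroup.of a, fun x => ?_⟩
    induction x using FreeGroup.induction_on with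
    | C1 => exact one_mem _
    | of b => rw [Subsingleton.elim b a]; exact Subgroup.mem_zpowers _
    | inv_of b hb => exact inv_mem hb
    | mul x y hx hy => exact mul_mem hx hy

lemma exists_surjective_of_nontrivial_generators {S : Type*} [Group S] [IsFreeGroup S]
    [Nontrivial (IsFreeGroup.Generators S)] :
    ∃ φ : S →* FreeGroup (Fin 2), Function.Surjective φ := by
  classical
  obtain ⟨a, b, hab⟩ := exists_pair_ne (IsFreeGroup.Generators S)
  let p : FreeGroup (IsFreeGroup.Generators S) →* FreeGroup (Fin 2) :=
    FreeGroup.map fun x => if x = a then 0 else 1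
  have hp : Function.Surjective p := FreeGroup.map_surjective fun i => by
    fin_cases i
    · exact ⟨a, by simp⟩
    · exact ⟨b, by simp [hab.symm]⟩
  exact ⟨p.comp (IsFreeGroup.toFreeGroup S).toMonoidHom,
    hp.comp (IsFreeGroup.toFreeGroup S).surjective⟩

/-- A subgroup of a free group whose image under two homomorphisms to `ℤ` has rank two surjects
onto a free group of rank two. -/
lemma exists_surjective_of_det_ne {S Q : Type} [Group S] [Group Q] [IsFreeGroup Q] (ψ : S →* Q)
    (e₁ e₂ : Q →* Multiplicative ℤ) (u v : S)
    (h : (e₁ (ψ u)).toAdd * (e₂ (ψ v)).toAdd ≠ (e₁ (ψ v)).toAdd * (e₂ (ψ u)).toAdd) :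
    ∃ φ : S →* FreeGroup (Fin 2), Function.Surjective φ ∧ ψ.ker ≤ φ.ker := by
  rcases subsingleton_or_nontrivial (IsFreeGroup.Generators ψ.range) with hs | hs
  · exfalso
    obtain ⟨c, hc⟩ := FreeGroup.mem_zpowers_of_subsingleton
      (α := IsFreeGroup.Generators ψ.range)
    have hpow : ∀ w : S, ∃ n : ℤ,
        ψ w = ((IsFreeGroup.toFreeGroup ψ.range).symm c : Q) ^ n := by
      intro w
      obtain ⟨n, hn⟩ := hc (IsFreeGroup.toFreeGroup ψ.range (ψ.rangeRestrict w))
      refine ⟨n, ?_⟩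
      have h1 := congrArg (IsFreeGroup.toFreeGroup ψ.range).symm hn
      simp only [map_zpow, MulEquiv.symm_apply_apply] at h1
      exact (congrArg Subtype.val h1).symm
    obtain ⟨m, hm⟩ := hpow u
    obtain ⟨n, hn⟩ := hpow v
    apply h
    rw [hm, hn]
    simp only [map_zpow, toAdd_zpow, smul_eq_mul]
    ring
  · obtain ⟨φ, hφ⟩ := exists_surjective_of_nontrivial_generators (S := ψ.range)
    refine ⟨φ.comp ψ.rangeRestrict, hφ.comp ψ.rangeRestrict_surjective, fun x hx => ?_⟩
    have : ψ.rangeRestrict x = 1 := Subtype.ext hx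
    rw [MonoidHom.mem_ker, MonoidHom.comp_apply, this, map_one]

lemma isLarge_of_surjective_of_ker_le {F G : Type*} [Group F] [Group G] (π : F →* G)
    (hπ : Function.Surjective π) (H : Subgroup F) [H.FiniteIndex]
    (φ : H →* FreeGroup (Fin 2)) (hφ : Function.Surjective φ)
    (hker : ∀ x ∈ π.ker, ∀ h : x ∈ H, φ ⟨x, h⟩ = 1) : IsLarge G := by
  have hle : (π.subgroupMap H).ker ≤ φ.ker := by
    rintro ⟨x, hx⟩ h
    exact hker x (congrArg Subtype.val h) hx
  refine ⟨H.map π, ⟨fun h => ?_⟩,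
    (π.subgroupMap H).liftOfSurjective (π.subgroupMap_surjective H) ⟨φ, hle⟩, ?_⟩
  · exact Subgroup.FiniteIndex.index_ne_zero (Nat.eq_zero_of_zero_dvd
      (h ▸ Subgroup.index_map_dvd H hπ))
  · intro q
    obtain ⟨x, rfl⟩ := hφ q
    exact ⟨π.subgroupMap H x, MonoidHom.liftOfRightInverse_comp_apply _ _ _ ⟨φ, hle⟩ x⟩

/-- A map `c : G → Y → Q` satisfying the cocycle identity over an action of `G` on `Y`. -/
def IsCocycle {G Y Q : Type*} [Group G] [MulAction G Y] [Mul Q] (c : G → Y → Q) : Prop :=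
  ∀ g h y, c (g * h) y = c g (h • y) * c h y

/-- The additive version of `IsCocycle`. -/
def IsAddCocycle {G Y A : Type*} [Group G] [MulAction G Y] [Add A] (c : G → Y → A) : Prop :=
  ∀ g h y, c (g * h) y = c g (h • y) + c h y

section Cocycle

variable {G Y : Type*} [Group G] [MulAction G Y]

lemma IsCocycle.map_one {Q : Type*} [Group Q] {c : G → Y → Q} (hc : IsCocycle c) (y : Y) :
    c 1 y = 1 := by
  have := hc 1 1 y
  simpa using this

lemma IsCocycle.map_inv {Q : Type*} [Group Q] {c : G → Y → Q} (hc : IsCocycle c) (g : G) (y : Y) :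
    c g⁻¹ y = (c g (g⁻¹ • y))⁻¹ := by
  have := hc g g⁻¹ y
  rw [mul_inv_cancel, hc.map_one] at this
  exact eq_inv_of_mul_eq_one_right this.symm

lemma IsAddCocycle.ofAdd {A : Type*} [Add A] {c : G → Y → A} (hc : IsAddCocycle c) :
    IsCocycle fun g y => Multiplicative.ofAdd (c g y) := fun g h y =>
  congrArg Multiplicative.ofAdd (hc g h y)

lemma IsCocycle.comp {Q Q' : Type*} [Group Q] [Group Q'] {c : G → Y → Q} (hc : IsCocycle c)
    (f : Q →* Q') : IsCocycle fun g y => f (c g y) := fun g h y => by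
  simp only [hc g h y, _root_.map_mul]

lemma IsAddCocycle.map_one {A : Type*} [AddGroup A] {c : G → Y → A} (hc : IsAddCocycle c)
    (y : Y) : c 1 y = 0 := hc.ofAdd.map_one y

lemma IsAddCocycle.map_inv {A : Type*} [AddGroup A] {c : G → Y → A} (hc : IsAddCocycle c) (g : G)
    (y : Y) : c g⁻¹ y = -c g (g⁻¹ • y) := hc.ofAdd.map_inv g y

/-- The elements acting trivially on `Y` on which a cocycle vanishes. -/
def IsCocycle.ker {Q : Type*} [Group Q] {c : G → Y → Q} (hc : IsCocycle c) : Subgroup G where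
  carrier := {w | ∀ y, w • y = y ∧ c w y = 1}
  one_mem' y := ⟨one_smul _ _, hc.map_one y⟩
  mul_mem' {a b} ha hb y := by
    rw [mul_smul, hc, (hb y).1, (hb y).2, (ha y).1, (ha y).2, mul_one]
    exact ⟨rfl, rfl⟩
  inv_mem' {a} ha y := by
    have h : a⁻¹ • y = y := by rw [inv_smul_eq_iff, (ha y).1]
    rw [hc.map_inv, h, (ha y).2, inv_one]
    exact ⟨rfl, rfl⟩

lemma IsCocycle.ker_normal {Q : Type*} [Group Q] {c : G → Y → Q} (hc : IsCocycle c) :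
    hc.ker.Normal where
  conj_mem n hn g y := by
    rw [mul_smul, mul_smul, hc, hc, (hn _).1, (hn _).2, smul_inv_smul, mul_one, hc.map_inv,
      mul_inv_cancel]
    exact ⟨rfl, rfl⟩

end Cocycle

lemma isLarge_of_cocycle {G Y : Type} [Group G] [Finite Y] [MulAction G Y] (R : Set G)
    {c : G → Y → FreeGroup (Fin 2)} (hc : IsCocycle c)
    (hR : ∀ w ∈ R, ∀ y, w • y = y ∧ c w y = 1) (e₁ e₂ : FreeGroup (Fin 2) →* Multiplicative ℤ)
    {y : Y} {u v : G} (hu : u • y = y) (hv : v • y = y)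
    (h : (e₁ (c u y)).toAdd * (e₂ (c v y)).toAdd ≠ (e₁ (c v y)).toAdd * (e₂ (c u y)).toAdd) :
    IsLarge (G ⧸ Subgroup.normalClosure R) := by
  let ψ : MulAction.stabilizer G y →* FreeGroup (Fin 2) :=
    { toFun := fun w => c w y
      map_one' := hc.map_one y
      map_mul' := fun a b => by
        rw [Subgroup.coe_mul, hc, MulAction.mem_stabilizer_iff.mp b.2] }
  have hK : Subgroup.normalClosure R ≤ hc.ker :=
    have := hc.ker_normal
    Subgroup.normalClosure_le_normal hR
  have : (MulAction.stabilizer G y).FiniteIndex := ⟨by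
    rw [MulAction.index_stabilizer]
    exact ((Set.ncard_pos (Set.toFinite _)).mpr (MulAction.nonempty_orbit y)).ne'⟩
  obtain ⟨φ, hφ, hker⟩ := exists_surjective_of_det_ne ψ e₁ e₂ ⟨u, hu⟩ ⟨v, hv⟩ h
  refine isLarge_of_surjective_of_ker_le (QuotientGroup.mk' _) (QuotientGroup.mk'_surjective _)
    (MulAction.stabilizer G y) φ hφ fun w hw hwy => hker ?_
  rw [QuotientGroup.ker_mk'] at hw
  exact (hK hw y).2

section FreeCocycle

variable {ι : Type}

lemma exists_cocycle {Y Q : Type*} [MulAction (FreeGroup ι) Y] [Group Q] (f : ι → Y → Q) :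
    ∃ c : FreeGroup ι → Y → Q, IsCocycle c ∧ ∀ i y, c (FreeGroup.of i) y = f i y := by
  let Φ : FreeGroup ι →* Equiv.Perm (Y × Q) := FreeGroup.lift fun i =>
    { toFun := fun p => (FreeGroup.of i • p.1, f i p.1 * p.2)
      invFun := fun p => ((FreeGroup.of i)⁻¹ • p.1, (f i ((FreeGroup.of i)⁻¹ • p.1))⁻¹ * p.2)
      left_inv := fun p => by simp
      right_inv := fun p => by simp }
  have hΦ : ∀ w, ∃ c : Y → Q, ∀ y q, Φ w (y, q) = (w • y, c y * q) := by
    intro w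
    induction w using FreeGroup.induction_on with
    | C1 => exact ⟨fun _ => 1, fun y q => by simp⟩
    | of i => exact ⟨f i, fun y q => by simp [Φ]⟩
    | inv_of i _ =>
      refine ⟨fun y => (f i ((FreeGroup.of i)⁻¹ • y))⁻¹, fun y q => ?_⟩
      rw [map_inv, Equiv.Perm.inv_eq_iff_eq]
      simp [Φ]
    | mul a b ha hb =>
      obtain ⟨ca, ha⟩ := ha
      obtain ⟨cb, hb⟩ := hb
      exact ⟨fun y => ca (b • y) * cb y, fun y q => by
        rw [map_mul, Equiv.Perm.mul_apply, hb, ha, mul_smul, mul_assoc]⟩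
  choose c hc using hΦ
  refine ⟨c, fun g h y => ?_, fun i y => ?_⟩
  · have h1 := hc (g * h) y 1
    rw [map_mul, Equiv.Perm.mul_apply, hc, hc] at h1
    simpa using (congrArg Prod.snd h1).symm
  · have h1 := hc (FreeGroup.of i) y 1
    simpa [Φ] using (congrArg Prod.snd h1).symm

/-- The value of a cocycle at a word only depends on its values on generators at finitely many
translates of the base point. -/
lemma exists_finset_cocycle_congr (w : FreeGroup ι) : ∃ S : Finset (FreeGroup ι),
    ∀ {Y Q : Type} [MulAction (FreeGroup ι) Y] [Group Q] {c c' : FreeGroup ι → Y → Q},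
      IsCocycle c → IsCocycle c' → ∀ y,
      (∀ u ∈ S, ∀ i, c (FreeGroup.of i) (u • y) = c' (FreeGroup.of i) (u • y)) →
      c w y = c' w y := by
  classical
  induction w using FreeGroup.induction_on with
  | C1 => exact ⟨∅, fun hc hc' y _ => by rw [hc.map_one, hc'.map_one]⟩
  | of i => exact ⟨{1}, fun hc hc' y h => by simpa using h 1 (by simp) i⟩
  | inv_of i _ =>
    exact ⟨{(FreeGroup.of i)⁻¹}, fun hc hc' y h => by
      rw [hc.map_inv, hc'.map_inv, h _ (by simp)]⟩
  | mul a b ha hb =>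
    obtain ⟨Sa, ha⟩ := ha
    obtain ⟨Sb, hb⟩ := hb
    refine ⟨Sa.image (· * b) ∪ Sb, fun hc hc' y h => ?_⟩
    rw [hc, hc', hb hc hc' y fun u hu => h u (by simp [hu]), ha hc hc' (b • y) fun u hu i => ?_]
    rw [← mul_smul]
    exact h _ (Finset.mem_union_left _ (Finset.mem_image_of_mem _ hu)) i

lemma IsCocycle.ext {Y Q : Type} [MulAction (FreeGroup ι) Y] [Group Q]
    {c c' : FreeGroup ι → Y → Q} (hc : IsCocycle c) (hc' : IsCocycle c')
    (h : ∀ i y, c (FreeGroup.of i) y = c' (FreeGroup.of i) y) : c = c' := by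
  funext w y
  obtain ⟨S, hS⟩ := exists_finset_cocycle_congr w
  exact hS hc hc' y fun u _ i => h i _

lemma exists_addCocycle {Y A : Type*} [MulAction (FreeGroup ι) Y] [AddGroup A] (f : ι → Y → A) :
    ∃ c : FreeGroup ι → Y → A, IsAddCocycle c ∧ ∀ i y, c (FreeGroup.of i) y = f i y := by
  obtain ⟨c, hc, h⟩ := exists_cocycle (Q := Multiplicative A) f
  exact ⟨c, hc, h⟩

lemma IsAddCocycle.ext {Y A : Type} [MulAction (FreeGroup ι) Y] [AddGroup A]
    {c c' : FreeGroup ι → Y → A} (hc : IsAddCocycle c) (hc' : IsAddCocycle c')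
    (h : ∀ i y, c (FreeGroup.of i) y = c' (FreeGroup.of i) y) : c = c' :=
  IsCocycle.ext (Q := Multiplicative A) hc hc' h

end FreeCocycle

lemma IsAddCocycle.exists_eq_sub {G Y A : Type*} [Group G] [MulAction G Y] [AddCommGroup A]
    {c : G → Y → A} (hc : IsAddCocycle c) (h : ∀ g y, g • y = y → c g y = 0) :
    ∃ b : Y → A, ∀ g y, c g y = b (g • y) - b y := by
  let p : Y → Y := fun y => (Quotient.mk (MulAction.orbitRel G Y) y).out
  have hp : ∀ g y, p (g • y) = p y := fun g y =>
    congrArg Quotient.out (Quotient.sound (s := MulAction.orbitRel G Y) ⟨g, rfl⟩)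
  have ht : ∀ y, ∃ t : G, t • p y = y := fun y => by
    have : MulAction.orbitRel G Y (p y) y := Quotient.mk_out (s := MulAction.orbitRel G Y) y
    obtain ⟨t, ht⟩ := (MulAction.orbitRel G Y).symm this
    exact ⟨t, ht⟩
  choose t ht using ht
  refine ⟨fun y => c (t y) (p y), fun g y => ?_⟩
  have hfix : ((t (g • y))⁻¹ * (g * t y)) • p y = p y := by
    rw [mul_smul, mul_smul, ht, inv_smul_eq_iff]
    conv_rhs => rw [← hp g y, ht]
  have h1 : c (g * t y) (p y) = c (t (g • y)) (p y) := by
    conv_lhs => rw [← mul_inv_cancel_left (t (g • y)) (g * t y)]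
    rw [hc, hfix, h _ _ hfix, add_zero]
  rw [hc, ht] at h1
  change c g y = c (t (g • y)) (p (g • y)) - c (t y) (p y)
  rw [hp, ← h1, add_sub_cancel_right]

lemma IsAddCocycle.apply_smul_of_commute {G Y A : Type*} [Group G] [MulAction G Y] [AddCommGroup A]
    {c : G → Y → A} (hc : IsAddCocycle c) {R z : G} (hz : Commute z R) (y : Y) (hR : R • y = y) :
    c R (z • y) = c R y := by
  have h := hc R z y
  rw [← hz.eq, hc, hR, add_comm] at h
  exact (add_right_cancel h).symm

lemma card_orbitRel_quotient_zpowers_mul_le {G Y : Type*} [Group G] [MulAction G Y] [Finite Y]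
    (g : G) (n : ℕ) (hinj : ∀ y : Y, Set.InjOn (fun t : ℕ => g ^ t • y) (Set.Iio n)) :
    n * Nat.card (MulAction.orbitRel.Quotient (Subgroup.zpowers g) Y) ≤ Nat.card Y := by
  classical
  have := Fintype.ofFinite Y
  let f : Y → MulAction.orbitRel.Quotient (Subgroup.zpowers g) Y := Quotient.mk _
  have hf : Function.Surjective f := Quotient.mk_surjective
  have := Fintype.ofSurjective f hf
  rw [Nat.card_eq_fintype_card, Nat.card_eq_fintype_card, ← Finset.card_univ, ← Finset.card_univ,
    ← Finset.image_univ_of_surjective hf]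
  refine Finset.mul_card_image_le_card _ _ fun a _ => ?_
  obtain ⟨y, rfl⟩ := hf a
  calc n = ((Finset.range n).image fun t => g ^ t • y).card := by
        rw [Finset.card_image_of_injOn (by simpa [Set.Iio] using hinj y), Finset.card_range]
    _ ≤ _ := Finset.card_le_card fun x hx => by
        obtain ⟨t, -, rfl⟩ := Finset.mem_image.mp hx
        refine Finset.mem_filter.mpr ⟨Finset.mem_univ _, Quotient.sound ?_⟩
        exact ⟨⟨g ^ t, Subgroup.npow_mem_zpowers g t⟩, rfl⟩

lemma exists_int_mul_eq {α : Type*} [Finite α] (f : α → ℚ) :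
    ∃ D : ℤ, D ≠ 0 ∧ ∃ z : α → ℤ, ∀ a, (z a : ℚ) = D * f a := by
  obtain ⟨b, hb⟩ := IsLocalization.exist_integer_multiples_of_finite (nonZeroDivisors ℤ) f
  choose z hz using hb
  exact ⟨b, nonZeroDivisors.ne_zero b.2, z, fun a => by simpa using hz a⟩

/-- If the elements `g k ^ n k` act trivially on `Y`, with all orbits of `g k` long, then there is
an integral cocycle vanishing on them and on a prescribed small set of vertices, which is not
a coboundary away from this set. -/
lemma exists_addCocycle_not_coboundary {ι κ Y : Type} [Fintype ι] [Fintype κ] [Finite Y]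
    [MulAction (FreeGroup ι) Y] (hι : 2 ≤ Fintype.card ι) (g : κ → FreeGroup ι) (n : κ → ℕ)
    (hn : ∀ k, 2 * Fintype.card κ ≤ n k) (hfix : ∀ k (y : Y), g k ^ n k • y = y)
    (hinj : ∀ k (y : Y), Set.InjOn (fun t : ℕ => g k ^ t • y) (Set.Iio (n k)))
    (B : Finset Y) (hB : 4 * B.card < Nat.card Y) :
    ∃ c : FreeGroup ι → Y → ℤ, IsAddCocycle c ∧ (∀ k y, c (g k ^ n k) y = 0) ∧
      (∀ i, ∀ y ∈ B, c (FreeGroup.of i) y = 0) ∧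
      ¬ ∃ b : Y → ℚ, ∀ i, ∀ y ∉ B,
        (c (FreeGroup.of i) y : ℚ) = b (FreeGroup.of i • y) - b y := by
  classical
  have := Fintype.ofFinite Y
  let E := {y : Y // y ∉ B}
  let L := ι → E → ℚ
  let O : κ → Type := fun k => MulAction.orbitRel.Quotient (Subgroup.zpowers (g k)) Y
  have : ∀ k, Finite (O k) := fun k => Quotient.finite _
  have := fun k => Fintype.ofFinite (O k)
  have hex : ∀ l : L, ∃ c : FreeGroup ι → Y → ℚ, IsAddCocycle c ∧
      ∀ i y, c (FreeGroup.of i) y = if h : y ∈ B then 0 else l i ⟨y, h⟩ := fun l =>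
    exists_addCocycle _
  choose ext hext hext' using hex
  let T : L →ₗ[ℚ] ((x : Σ k, O k) → ℚ) :=
    { toFun := fun l x => ext l (g x.1 ^ n x.1) (Quotient.out x.2)
      map_add' := fun l l' => by
        have : ext (l + l') = ext l + ext l' := (hext _).ext
          (fun a b y => by simp only [Pi.add_apply, hext l a b y, hext l' a b y]; abel)
          fun i y => by
            simp only [Pi.add_apply, hext']
            split_ifs
            · exact (add_zero 0).symm
            · rfl
        rw [this]
        rfl
      map_smul' := fun r l => by
        have : ext (r • l) = r • ext l := (hext _).ext
          (fun a b y => by simp only [Pi.smul_apply, hext l a b y, smul_add])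
          fun i y => by
            simp only [Pi.smul_apply, hext']
            split_ifs
            · exact (smul_zero r).symm
            · rfl
        rw [this]
        rfl }
  let δ : (Y → ℚ) →ₗ[ℚ] L :=
    { toFun := fun b i y => b (FreeGroup.of i • y.1) - b y.1
      map_add' := fun b b' => by
        ext i y
        exact add_sub_add_comm _ _ _ _
      map_smul' := fun r b => by
        ext i y
        exact (mul_sub r _ _).symm }
  have hnle : ¬ LinearMap.ker T ≤ LinearMap.range δ := by
    intro hle
    have h1 := LinearMap.finrank_range_add_finrank_ker T
    have h2 : Module.finrank ℚ (LinearMap.range T) ≤ ∑ k, Fintype.card (O k) := by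
      refine (Submodule.finrank_le _).trans ?_
      rw [Module.finrank_fintype_fun_eq_card, Fintype.card_sigma]
    have h3 : Module.finrank ℚ (LinearMap.ker T) ≤ Fintype.card Y := by
      refine (Submodule.finrank_mono hle).trans ((LinearMap.finrank_range_le δ).trans ?_)
      rw [Module.finrank_fintype_fun_eq_card]
    have h4 : Module.finrank ℚ L = Fintype.card ι * (Fintype.card Y - B.card) := by
      rw [Module.finrank_pi_fintype]
      simp [E]
    have h5 : 2 * ∑ k, Fintype.card (O k) ≤ Fintype.card Y := by
      rcases isEmpty_or_nonempty κ with hκ | hκ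
      · simp
      refine Nat.le_of_mul_le_mul_left ?_ (Fintype.card_pos (α := κ))
      calc Fintype.card κ * (2 * ∑ k, Fintype.card (O k))
          = ∑ k, 2 * Fintype.card κ * Fintype.card (O k) := by rw [← Finset.mul_sum]; ring
        _ ≤ ∑ _k : κ, Fintype.card Y := Finset.sum_le_sum fun k _ => by
            have := card_orbitRel_quotient_zpowers_mul_le (g k) (n k) (hinj k)
            rw [Nat.card_eq_fintype_card, Nat.card_eq_fintype_card] at this
            exact (Nat.mul_le_mul_right _ (hn k)).trans this
        _ = Fintype.card κ * Fintype.card Y := by simp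
    rw [Nat.card_eq_fintype_card] at hB
    have h6 : 2 * (Fintype.card Y - B.card) ≤ Fintype.card ι * (Fintype.card Y - B.card) :=
      Nat.mul_le_mul_right _ hι
    omega
  obtain ⟨l, hl, hlδ⟩ := SetLike.not_le_iff_exists.mp hnle
  obtain ⟨D, hD, z, hz⟩ := exists_int_mul_eq fun p : ι × Y => ext l (FreeGroup.of p.1) p.2
  obtain ⟨c, hc, hcz⟩ := exists_addCocycle fun i (y : Y) => z (i, y)
  have hcast : (fun w y => (c w y : ℚ)) = fun w y => D * ext l w y :=
    IsAddCocycle.ext (fun a b y => by simp only [hc a b y, Int.cast_add])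
      (fun a b y => by simp only [hext l a b y, mul_add])
      fun i y => by simp only [hcz, hz]
  have hcast' : ∀ w y, (c w y : ℚ) = D * ext l w y := fun w y => congrFun (congrFun hcast w) y
  refine ⟨c, hc, fun k y => ?_, fun i y hy => ?_, ?_⟩
  · have h1 : ext l (g k ^ n k) (Quotient.out (s := MulAction.orbitRel (Subgroup.zpowers (g k)) Y)
        (Quotient.mk _ y)) = 0 := congrFun hl (⟨k, Quotient.mk _ y⟩ : Σ k, O k)
    obtain ⟨⟨w, hw⟩, hwy⟩ := Quotient.mk_out (s := MulAction.orbitRel (Subgroup.zpowers (g k)) Y) y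
    have hwy' : w • y = Quotient.out (s := MulAction.orbitRel (Subgroup.zpowers (g k)) Y)
        (Quotient.mk _ y) := hwy
    obtain ⟨j, rfl⟩ := hw
    rw [← hwy', (hext l).apply_smul_of_commute
      (((Commute.refl (g k)).zpow_left j).pow_right (n k)) y (hfix k y)] at h1
    have h2 := hcast' (g k ^ n k) y
    rw [h1, mul_zero] at h2
    exact_mod_cast h2
  · have h2 := hcast' (FreeGroup.of i) y
    rw [hext', dif_pos hy, mul_zero] at h2
    exact_mod_cast h2
  · rintro ⟨b, hb⟩
    have hD' : (D : ℚ) ≠ 0 := by exact_mod_cast hD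
    refine hlδ ⟨fun y => b y / D, ?_⟩
    ext i ⟨y, hy⟩
    have h2 := hb i y hy
    rw [hcast', hext', dif_neg hy] at h2
    change b (FreeGroup.of i • y) / D - b y / D = l i ⟨y, hy⟩
    rw [← sub_div, ← h2, mul_div_cancel_left₀ _ hD']

lemma IsAddCocycle.map_conj_inv {G Y A : Type*} [Group G] [MulAction G Y] [AddCommGroup A]
    {c : G → Y → A} (hc : IsAddCocycle c) (g w : G) (y : Y) (hw : w • y = y) :
    c (g * w * g⁻¹) (g • y) = c w y := by
  rw [hc, hc, hc.map_inv, inv_smul_smul, hw]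
  abel

/-- If a cocycle has proportional values, on the stabilizer of each point, to an integral cocycle
which is nonzero on some loop at each point, then it is a coboundary wherever the latter vanishes
on generators. -/
lemma IsAddCocycle.exists_eq_sub_of_det_eq {ι Y : Type} [MulAction (FreeGroup ι) Y]
    {σ β : FreeGroup ι → Y → ℤ} (hσ : IsAddCocycle σ) (hβ : IsAddCocycle β)
    (hloop : ∀ y, ∃ w : FreeGroup ι, w • y = y ∧ σ w y ≠ 0)
    (hdet : ∀ (y : Y) (u v : FreeGroup ι), u • y = y → v • y = y →
      σ u y * β v y = σ v y * β u y) :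
    ∃ b : Y → ℚ, ∀ g y, σ g y = 0 → (β g y : ℚ) = b (g • y) - b y := by
  choose w hw hw0 using hloop
  let r : Y → ℚ := fun y => β (w y) y / σ (w y) y
  have hr : ∀ y v, v • y = y → (β v y : ℚ) = r y * σ v y := fun y v hv => by
    have h0 : (σ (w y) y : ℚ) ≠ 0 := by exact_mod_cast hw0 y
    have := hdet y (w y) v (hw y) hv
    have : (σ (w y) y : ℚ) * β v y = σ v y * β (w y) y := by exact_mod_cast this
    simp only [r]
    field_simp
    linarith
  have hr' : ∀ (g : FreeGroup ι) y, r (g • y) = r y := fun g y => by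
    have h0 : (σ (w y) y : ℚ) ≠ 0 := by exact_mod_cast hw0 y
    have h1 : (g * w y * g⁻¹) • g • y = g • y := by
      rw [mul_smul, inv_smul_smul, mul_smul, hw]
    have h2 := hr (g • y) _ h1
    rw [hσ.map_conj_inv _ _ _ (hw y), hβ.map_conj_inv _ _ _ (hw y), hr y _ (hw y)] at h2
    exact (mul_right_cancel₀ h0 h2).symm
  have hc : IsAddCocycle fun g y => (β g y : ℚ) - r y * σ g y := fun g h y => by
    simp only [hβ g h y, hσ g h y, hr' h y, Int.cast_add]
    ring
  obtain ⟨b, hb⟩ := hc.exists_eq_sub fun g y hg => sub_eq_zero.mpr (hr y g hg)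
  exact ⟨b, fun g y h => by simpa [h] using hb g y⟩

lemma isLarge_of_addCocycle {ι κ Y : Type} [Fintype ι] [Fintype κ] [Finite Y]
    [MulAction (FreeGroup ι) Y] (hι : 2 ≤ Fintype.card ι) (g : κ → FreeGroup ι) (n : κ → ℕ)
    (hn : ∀ k, 2 * Fintype.card κ ≤ n k) (hfix : ∀ k (y : Y), g k ^ n k • y = y)
    (hinj : ∀ k (y : Y), Set.InjOn (fun t : ℕ => g k ^ t • y) (Set.Iio (n k)))
    (S : Finset (FreeGroup ι)) (hS1 : 1 ∈ S)
    (hS : ∀ k, ∀ {c c' : FreeGroup ι → Y → FreeGroup (Fin 2)}, IsCocycle c → IsCocycle c' →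
      ∀ y, (∀ u ∈ S, ∀ i, c (FreeGroup.of i) (u • y) = c' (FreeGroup.of i) (u • y)) →
      c (g k ^ n k) y = c' (g k ^ n k) y)
    {σ : FreeGroup ι → Y → ℤ} (hσ : IsAddCocycle σ) (hσg : ∀ k y, σ (g k ^ n k) y = 0)
    (hloop : ∀ y, ∃ w : FreeGroup ι, w • y = y ∧ σ w y ≠ 0) (W : Finset Y)
    (hW : ∀ y i, σ (FreeGroup.of i) y ≠ 0 → y ∈ W)
    (hcard : 4 * (S.card ^ 2 * W.card) < Nat.card Y) :
    IsLarge (FreeGroup ι ⧸ Subgroup.normalClosure (Set.range fun k => g k ^ n k)) := by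
  classical
  let B : Finset Y := ((S ×ˢ S) ×ˢ W).image fun p => (p.1.1 * p.1.2⁻¹) • p.2
  have hB : 4 * B.card < Nat.card Y := by
    refine lt_of_le_of_lt (Nat.mul_le_mul_left 4 (Finset.card_image_le.trans ?_)) hcard
    rw [Finset.card_product, Finset.card_product, sq]
  have hmem : ∀ u ∈ S, ∀ v ∈ S, ∀ y, v • y ∈ W → u • y ∈ B := fun u hu v hv y hy =>
    Finset.mem_image.mpr ⟨((u, v), v • y), by simp [hu, hv, hy], by
      rw [mul_smul, inv_smul_smul]⟩
  obtain ⟨β, hβ, hβg, hβB, hβb⟩ := exists_addCocycle_not_coboundary hι g n hn hfix hinj B hB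
  let x₁ : FreeGroup (Fin 2) := FreeGroup.of 0
  let x₂ : FreeGroup (Fin 2) := FreeGroup.of 1
  have hpow : ∀ (x : FreeGroup (Fin 2)) {τ : FreeGroup ι → Y → ℤ}, IsAddCocycle τ →
      IsCocycle fun w y => x ^ τ w y := fun x τ hτ a b y => by
    simp only [hτ a b y, zpow_add]
  obtain ⟨Λ, hΛ, hΛ'⟩ := exists_cocycle fun i (y : Y) =>
    x₁ ^ σ (FreeGroup.of i) y * x₂ ^ β (FreeGroup.of i) y
  let e₁ : FreeGroup (Fin 2) →* Multiplicative ℤ :=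
    FreeGroup.lift ![Multiplicative.ofAdd 1, 1]
  let e₂ : FreeGroup (Fin 2) →* Multiplicative ℤ :=
    FreeGroup.lift ![1, Multiplicative.ofAdd 1]
  have he₁ : ∀ w y, (e₁ (Λ w y)).toAdd = σ w y := fun w y =>
    congrFun (congrFun (IsCocycle.ext (hΛ.comp e₁) hσ.ofAdd fun i y => by
      simp only [hΛ', map_mul, map_zpow]
      simp [e₁, x₁, x₂, ← ofAdd_zsmul]) w) y
  have he₂ : ∀ w y, (e₂ (Λ w y)).toAdd = β w y := fun w y =>
    congrFun (congrFun (IsCocycle.ext (hΛ.comp e₂) hβ.ofAdd fun i y => by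
      simp only [hΛ', map_mul, map_zpow]
      simp [e₂, x₁, x₂, ← ofAdd_zsmul]) w) y
  have hΛg : ∀ k y, Λ (g k ^ n k) y = 1 := fun k y => by
    by_cases h : ∀ u ∈ S, ∀ i, σ (FreeGroup.of i) (u • y) = 0
    · rw [hS k hΛ (hpow x₂ hβ) y fun u hu i => by rw [hΛ', h u hu i, zpow_zero, one_mul], hβg,
        zpow_zero]
    · push Not at h
      obtain ⟨v, hv, j, hj⟩ := h
      rw [hS k hΛ (hpow x₁ hσ) y fun u hu i => by
        rw [hΛ', hβB i _ (hmem u hu v hv y (hW _ j hj)), zpow_zero, mul_one], hσg, zpow_zero]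
  by_cases hdet : ∀ (y : Y) (u v : FreeGroup ι), u • y = y → v • y = y →
      σ u y * β v y = σ v y * β u y
  · exfalso
    obtain ⟨b, hb⟩ := hσ.exists_eq_sub_of_det_eq hβ hloop hdet
    refine hβb ⟨b, fun i y hy => hb _ _ ?_⟩
    by_contra h
    refine hy ?_
    simpa using hmem 1 hS1 1 hS1 y (by simpa using hW y i h)
  · push Not at hdet
    obtain ⟨y, u, v, hu, hv, h⟩ := hdet
    refine isLarge_of_cocycle _ hΛ ?_ e₁ e₂ hu hv (by simpa only [he₁, he₂] using h)
    rintro _ ⟨k, rfl⟩ z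
    exact ⟨hfix k z, hΛg k z⟩

/-- The action on the `ZMod m`-extension of `Y` defined by an integral cocycle. -/
abbrev IsAddCocycle.skewAction {G Y : Type*} [Group G] [MulAction G Y] {d : G → Y → ℤ}
    (hd : IsAddCocycle d) (m : ℕ) : MulAction G (Y × ZMod m) where
  smul g p := (g • p.1, p.2 + d g p.1)
  one_smul p := Prod.ext (one_smul G p.1) (by
    change p.2 + (d 1 p.1 : ZMod m) = p.2
    rw [hd.map_one, Int.cast_zero, add_zero])
  mul_smul g h p := Prod.ext (mul_smul g h p.1) (by
    change p.2 + (d (g * h) p.1 : ZMod m) = p.2 + d h p.1 + d g (h • p.1)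
    rw [hd, Int.cast_add]
    abel)

/-- The number of times an element wraps around `ZMod m` in the skew action. -/
def winding {G Y : Type*} (d : G → Y → ℤ) (m : ℕ) (g : G) (p : Y × ZMod m) : ℤ :=
  ((p.2.val : ℤ) + d g p.1) / m

lemma IsAddCocycle.isAddCocycle_winding {G Y : Type*} [Group G] [MulAction G Y] {d : G → Y → ℤ}
    (hd : IsAddCocycle d) (m : ℕ) [NeZero m] :
    letI := hd.skewAction m
    IsAddCocycle (winding d m) := by
  intro g h p
  have hm : (m : ℤ) ≠ 0 := by exact_mod_cast NeZero.ne m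
  have h1 : ((p.2 + (d h p.1 : ZMod m)).val : ℤ) = ((p.2.val : ℤ) + d h p.1) % m := by
    rw [← ZMod.val_intCast]
    simp
  change ((p.2.val : ℤ) + d (g * h) p.1) / m =
    (((p.2 + (d h p.1 : ZMod m)).val : ℤ) + d g (h • p.1)) / m + ((p.2.val : ℤ) + d h p.1) / m
  rw [h1, hd, ← Int.add_mul_ediv_right _ _ hm]
  congr 1
  linarith [Int.emod_add_mul_ediv ((p.2.val : ℤ) + d h p.1) m]

lemma IsAddCocycle.pow_of_fixed {G Y : Type*} [Group G] [MulAction G Y] {d : G → Y → ℤ}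
    (hd : IsAddCocycle d) {w : G} {y : Y} (hw : w • y = y) (t : ℕ) :
    w ^ t • y = y ∧ d (w ^ t) y = t * d w y := by
  induction t with
  | zero => simp [hd.map_one]
  | succ t ih =>
    rw [pow_succ, mul_smul, hw, hd, hw, ih.2]
    exact ⟨ih.1, by push_cast; ring⟩

lemma isLarge_of_pretransitive {ι κ Y : Type} [Fintype ι] [Fintype κ] [Finite Y] [Nonempty Y]
    [MulAction (FreeGroup ι) Y] [MulAction.IsPretransitive (FreeGroup ι) Y]
    (hι : 2 ≤ Fintype.card ι) (g : κ → FreeGroup ι) (n : κ → ℕ)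
    (hn : ∀ k, 2 * Fintype.card κ ≤ n k) (hfix : ∀ k (y : Y), g k ^ n k • y = y)
    (hinj : ∀ k (y : Y), Set.InjOn (fun t : ℕ => g k ^ t • y) (Set.Iio (n k))) :
    IsLarge (FreeGroup ι ⧸ Subgroup.normalClosure (Set.range fun k => g k ^ n k)) := by
  classical
  have := Fintype.ofFinite Y
  obtain ⟨d, hd, hdg, -, hdb⟩ := exists_addCocycle_not_coboundary hι g n hn hfix hinj (∅ : Finset Y)
    (by simpa using Fintype.card_pos)
  have hloop : ∀ y, ∃ w : FreeGroup ι, w • y = y ∧ d w y ≠ 0 := by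
    by_contra hcon
    push Not at hcon
    obtain ⟨x, hx⟩ := hcon
    have hall : ∀ (w : FreeGroup ι) y, w • y = y → d w y = 0 := fun w y hw => by
      obtain ⟨u, rfl⟩ := MulAction.exists_smul_eq (FreeGroup ι) y x
      rw [← hd.map_conj_inv u w y hw]
      exact hx _ (by rw [mul_smul, inv_smul_smul, mul_smul, hw])
    obtain ⟨b, hb⟩ := hd.exists_eq_sub hall
    exact hdb ⟨fun y => b y, fun i y _ => by rw [hb]; push_cast; rfl⟩
  choose S hS using fun k => exists_finset_cocycle_congr (g k ^ n k)
  let S' : Finset (FreeGroup ι) := insert 1 (Finset.univ.biUnion S)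
  obtain ⟨D, hD⟩ := Finite.exists_le fun p : ι × Y => (d (FreeGroup.of p.1) p.2).natAbs
  let m : ℕ := 8 * S'.card ^ 2 * D + 1
  have hm : (m : ℤ) ≠ 0 := by positivity
  have : NeZero m := ⟨Nat.succ_ne_zero _⟩
  let _ := hd.skewAction m
  have hsmul : ∀ (w : FreeGroup ι) (p : Y × ZMod m), w • p = (w • p.1, p.2 + (d w p.1 : ZMod m)) :=
    fun _ _ => rfl
  have hval : ∀ a : ZMod m, (a.val : ℤ) / m = 0 := fun a =>
    Int.ediv_eq_zero_of_lt (by positivity) (by exact_mod_cast a.val_lt)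
  let W : Finset (Y × ZMod m) :=
    Finset.univ ×ˢ (Finset.range D ∪ Finset.Ico (m - D) m).image fun a : ℕ => (a : ZMod m)
  refine isLarge_of_addCocycle (Y := Y × ZMod m) hι g n hn
    (fun k p => by rw [hsmul, hfix, hdg, Int.cast_zero, add_zero])
    (fun k p s hs t ht hst => hinj k p.1 hs ht (congrArg Prod.fst hst)) S'
    (Finset.mem_insert_self _ _)
    (fun k _ _ hc hc' y h => hS k hc hc' y fun u hu => h u
      (Finset.mem_insert_of_mem (Finset.mem_biUnion.mpr ⟨k, Finset.mem_univ _, hu⟩)))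
    (hd.isAddCocycle_winding m) (fun k p => ?_) (fun p => ?_) W (fun p i hp => ?_) ?_
  · rw [winding, hdg, add_zero, hval]
  · obtain ⟨w, hw, hw0⟩ := hloop p.1
    obtain ⟨h1, h2⟩ := hd.pow_of_fixed hw m
    refine ⟨w ^ m, ?_, ?_⟩
    · rw [hsmul, h1, h2]
      simp
    · rw [winding, h2, Int.add_mul_ediv_left _ _ hm, hval, zero_add]
      exact hw0
  · refine Finset.mem_product.mpr ⟨Finset.mem_univ _, Finset.mem_image.mpr
      ⟨p.2.val, ?_, ZMod.natCast_zmod_val p.2⟩⟩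
    rw [Finset.mem_union, Finset.mem_range, Finset.mem_Ico]
    by_contra hcon
    have hlt := p.2.val_lt
    have hDp : (d (FreeGroup.of i) p.1).natAbs ≤ D := hD (i, p.1)
    exact hp (Int.ediv_eq_zero_of_lt (by omega) (by omega))
  · have hW : W.card ≤ Fintype.card Y * (2 * D) := by
      rw [Finset.card_product, Finset.card_univ]
      refine Nat.mul_le_mul_left _ (Finset.card_image_le.trans ((Finset.card_union_le _ _).trans ?_))
      rw [Finset.card_range, Nat.card_Ico]
      omega
    rw [Nat.card_prod, Nat.card_zmod, Nat.card_eq_fintype_card]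
    calc 4 * (S'.card ^ 2 * W.card) ≤ 4 * (S'.card ^ 2 * (Fintype.card Y * (2 * D))) := by gcongr
      _ = Fintype.card Y * (8 * S'.card ^ 2 * D) := by ring
      _ < Fintype.card Y * m := Nat.mul_lt_mul_of_pos_left (Nat.lt_succ_self _) Fintype.card_pos

lemma isLarge_of_orderOf {ι κ P : Type} [Fintype ι] [Fintype κ] [Group P] [Finite P]
    (hι : 2 ≤ Fintype.card ι) (φ : FreeGroup ι →* P) (hφ : Function.Surjective φ)
    (g : κ → FreeGroup ι) (hg : ∀ k, 2 * Fintype.card κ ≤ orderOf (φ (g k))) :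
    IsLarge (FreeGroup ι ⧸
      Subgroup.normalClosure (Set.range fun k => g k ^ orderOf (φ (g k)))) := by
  let _ : MulAction (FreeGroup ι) P := MulAction.compHom P φ
  have hsmul : ∀ (w : FreeGroup ι) (x : P), w • x = φ w * x := fun _ _ => rfl
  have : MulAction.IsPretransitive (FreeGroup ι) P := ⟨fun x y => by
    obtain ⟨w, hw⟩ := hφ (y * x⁻¹)
    exact ⟨w, by rw [hsmul, hw, inv_mul_cancel_right]⟩⟩
  refine isLarge_of_pretransitive (Y := P) hι g _ hg (fun k x => ?_) fun k x s hs t ht hst => ?_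
  · rw [hsmul, map_pow, pow_orderOf_eq_one, one_mul]
  · simp only [hsmul, map_pow] at hst
    exact pow_injOn_Iio_orderOf hs ht (mul_right_cancel hst)

/-- Let F be a free group of rank r ≥ 2 and g₁,…,g_k ∈ F. Then
F/⟪g₁^q,…,g_k^q⟫ is large for all but finitely many q ∈ ℕ. -/
theorem stmt_10 (r : ℕ) (hr : 2 ≤ r) (k : ℕ) (g : Fin k → FreeGroup (Fin r)) :
    {q : ℕ | ¬ IsLarge (FreeGroup (Fin r) ⧸
        Subgroup.normalClosure {x | ∃ i : Fin k, x = (g i) ^ q})}.Finite := by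
  classical
  let κ := {i : Fin k // g i ≠ 1}
  let T : Finset (FreeGroup (Fin r)) :=
    (Finset.univ ×ˢ Finset.Ico 1 (2 * Fintype.card κ)).image fun p : κ × ℕ => g p.1 ^ p.2
  have hT : 1 ∉ T := fun h => by
    obtain ⟨⟨i, j⟩, hj, h1⟩ := Finset.mem_image.mp h
    simp only [Finset.mem_product, Finset.mem_Ico] at hj
    exact i.2 ((pow_eq_one_iff_left (by omega)).mp h1)
  obtain ⟨q₀, hq₀⟩ := exists_finite_quotient_exponent hr T hT
  refine (Set.finite_Iic q₀).subset fun q hq => Set.mem_Iic.mpr (not_lt.mp fun hlt => hq ?_)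
  obtain ⟨P, _, _, φ, hφ, hφT⟩ := hq₀ q hlt
  have hord : ∀ w, orderOf (φ.rangeRestrict w) ∣ q := fun w =>
    orderOf_dvd_of_pow_eq_one (Subtype.ext (hφ w))
  have hlarge := isLarge_of_orderOf (by simpa using hr) φ.rangeRestrict φ.rangeRestrict_surjective
    (fun i : κ => g i) fun i => by
      by_contra hcon
      refine hφT (g i ^ orderOf (φ.rangeRestrict (g i))) (Finset.mem_image.mpr
        ⟨(i, _), Finset.mem_product.mpr ⟨Finset.mem_univ _, Finset.mem_Ico.mpr
          ⟨orderOf_pos _, not_le.mp hcon⟩⟩, rfl⟩) ?_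
      have := pow_orderOf_eq_one (φ.rangeRestrict (g i))
      rw [← map_pow] at this
      exact congrArg Subtype.val this
  refine hlarge.of_surjective (QuotientGroup.map _ _ (MonoidHom.id _) ?_)
    (QuotientGroup.map_surjective_of_surjective _ _ _ (QuotientGroup.mk_surjective) _)
  refine Subgroup.normalClosure_le_normal ?_
  rintro _ ⟨i, rfl⟩
  change g i ^ q ∈ Subgroup.normalClosure _
  by_cases hi : g i = 1
  · rw [hi, one_pow]
    exact one_mem _
  · obtain ⟨c, hc⟩ := hord (g i)
    rw [hc, pow_mul]
    exact pow_mem (Subgroup.subset_normalClosure (Set.mem_range_self (⟨i, hi⟩ : κ))) c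
end
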